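/- arXiv:1303.4165 — 10 statements merged into one kernel-verified Lean document; each statement's English description precedes it below -/
import Mathlib

section
/- Let I ⊆ ℝ be an open interval and γ(s) = (x(s), y(s)) a smooth injective curve in ℝ² with x′(s) ≠ 0 and y′(s) ≠ 0 for every s ∈ I (tangent nowhere parallel to the coordinate axes), and let n(s) = (−y′(s), x′(s))/‖γ′(s)‖ be the Euclidean unit normal along γ. For any smooth functions φ₁, φ₂, ψ₁, ψ₂ : I → ℝ there exist an open set U ⊆ ℝ² containing γ(I) and smooth functions u, v : U → ℝ satisfying the wave map system (WM) on U together with the Cauchy conditions u(γ(s)) = φ₁(s), v(γ(s)) = φ₂(s), ∇u(γ(s))·n(s) = ψ₁(s), ∇v(γ(s))·n(s) = ψ₂(s) for all s ∈ I. Moreover the solution is locally unique: if (u₁, v₁) on an open U₁ ⊇ γ(I) and (u₂, v₂) on an open U₂ ⊇ γ(I) both satisfy (WM) and these Cauchy conditions, then there is an open set W with γ(I) ⊆ W ⊆ U₁ ∩ U₂ on which u₁ = u₂ and v₁ = v₂. -/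
/-- Partial derivative in the first (x) variable. -/
noncomputable def px (u : ℝ → ℝ → ℝ) (x y : ℝ) : ℝ :=
  deriv (fun x' => u x' y) x

/-- Partial derivative in the second (y) variable. -/
noncomputable def py (u : ℝ → ℝ → ℝ) (x y : ℝ) : ℝ :=
  deriv (fun y' => u x y') y

/-- Mixed partial derivative `u_{xy}` (the y-derivative of `u_x`). -/
noncomputable def pxy (u : ℝ → ℝ → ℝ) (x y : ℝ) : ℝ :=
  deriv (fun y' => px u x y') y

/-- The Darboux integrable wave map system (WM):
`u_{xy} + u_x u_y/(2(1+exp((u+v)/2))) = 0`,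
`v_{xy} + v_x v_y/(2(1+exp((u+v)/2))) = 0` on `U`. -/
def IsWaveMap (U : Set (ℝ × ℝ)) (u v : ℝ → ℝ → ℝ) : Prop :=
  ∀ p ∈ U,
    pxy u p.1 p.2 + px u p.1 p.2 * py u p.1 p.2 /
        (2 * (1 + Real.exp ((u p.1 p.2 + v p.1 p.2) / 2))) = 0 ∧
    pxy v p.1 p.2 + px v p.1 p.2 * py v p.1 p.2 /
        (2 * (1 + Real.exp ((u p.1 p.2 + v p.1 p.2) / 2))) = 0

/-- The derivative of `u` at `γ s` in the direction of the Euclidean unit normal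
`n(s) = (-y'(s), x'(s)) / ‖γ'(s)‖` along the curve `γ`. -/
noncomputable def normalDeriv (u : ℝ → ℝ → ℝ) (γ : ℝ → ℝ × ℝ) (s : ℝ) : ℝ :=
  (px u (γ s).1 (γ s).2 * (-(deriv (fun r => (γ r).2) s)) +
      py u (γ s).1 (γ s).2 * deriv (fun r => (γ r).1) s) /
    Real.sqrt ((deriv (fun r => (γ r).1) s) ^ 2 + (deriv (fun r => (γ r).2) s) ^ 2)

open Set Filter Topology
section

theorem hasDerivAt_partials {f : ℝ → ℝ → ℝ} {U : Set (ℝ × ℝ)} (hU : IsOpen U)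
    (hf : ContDiffOn ℝ 2 (fun p : ℝ × ℝ => f p.1 p.2) U) {z : ℝ × ℝ} (hz : z ∈ U) :
    HasFDerivAt (fun p : ℝ × ℝ => f p.1 p.2) (px f z.1 z.2 • ContinuousLinearMap.fst ℝ ℝ ℝ +
      py f z.1 z.2 • ContinuousLinearMap.snd ℝ ℝ ℝ) z ∧
    HasDerivAt (fun y => f z.1 y) (py f z.1 z.2) z.2 ∧
    HasDerivAt (fun y => px f z.1 y) (pxy f z.1 z.2) z.2 ∧
    HasDerivAt (fun x => py f x z.2) (pxy f z.1 z.2) z.1 ∧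
    ContinuousAt (fun p : ℝ × ℝ => px f p.1 p.2) z ∧
    ContinuousAt (fun p : ℝ × ℝ => py f p.1 p.2) z := by
  set F : ℝ × ℝ → ℝ := fun p => f p.1 p.2 with hF
  have hlineX : ∀ p : ℝ × ℝ, HasDerivAt (fun x => (x, p.2)) ((1 : ℝ), (0 : ℝ)) p.1 := fun p =>
    (hasDerivAt_id _).prodMk (hasDerivAt_const _ _)
  have hlineY : ∀ p : ℝ × ℝ, HasDerivAt (fun y => (p.1, y)) ((0 : ℝ), (1 : ℝ)) p.2 := fun p =>
    (hasDerivAt_const _ _).prodMk (hasDerivAt_id _)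
  have hd : ∀ p ∈ U, HasFDerivAt F (fderiv ℝ F p) p := fun p hp =>
    ((hf.contDiffAt (hU.mem_nhds hp)).differentiableAt (by norm_num)).hasFDerivAt
  have hX : ∀ p ∈ U, HasDerivAt (fun x => f x p.2) (fderiv ℝ F p (1, 0)) p.1 := fun p hp =>
    HasFDerivAt.comp_hasDerivAt (l := F) (f := fun x => (x, p.2)) p.1 (hd p hp) (hlineX p)
  have hY : ∀ p ∈ U, HasDerivAt (fun y => f p.1 y) (fderiv ℝ F p (0, 1)) p.2 := fun p hp =>
    HasFDerivAt.comp_hasDerivAt (l := F) (f := fun y => (p.1, y)) p.2 (hd p hp) (hlineY p)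
  have hpx : ∀ p ∈ U, px f p.1 p.2 = fderiv ℝ F p (1, 0) := fun p hp => (hX p hp).deriv
  have hpy : ∀ p ∈ U, py f p.1 p.2 = fderiv ℝ F p (0, 1) := fun p hp => (hY p hp).deriv
  have hz2 := hf.contDiffAt (hU.mem_nhds hz)
  have hG : ContDiffAt ℝ 1 (fderiv ℝ F) z := hz2.fderiv_right (by norm_num)
  have hG' : HasFDerivAt (fderiv ℝ F) (fderiv ℝ (fderiv ℝ F) z) z :=
    (hG.differentiableAt (by norm_num)).hasFDerivAt
  have hsymm := (hz2.isSymmSndFDerivAt (by simp)).eq (1, 0) (0, 1)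
  have hevX : ∀ᶠ x in 𝓝 z.1, (x, z.2) ∈ U :=
    (hlineX z).continuousAt.preimage_mem_nhds (hU.mem_nhds hz)
  have hevY : ∀ᶠ y in 𝓝 z.2, (z.1, y) ∈ U :=
    (hlineY z).continuousAt.preimage_mem_nhds (hU.mem_nhds hz)
  have hxy : HasDerivAt (fun y => px f z.1 y) (fderiv ℝ (fderiv ℝ F) z (0, 1) (1, 0)) z.2 := by
    have h : HasDerivAt (fun y => fderiv ℝ F (z.1, y) (1, 0))
        (fderiv ℝ (fderiv ℝ F) z (0, 1) (1, 0)) z.2 := by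
      have h1 := hG'.comp_hasDerivAt z.2 (hlineY z)
      simpa using h1.clm_apply (hasDerivAt_const z.2 ((1 : ℝ), (0 : ℝ)))
    exact h.congr_of_eventuallyEq (hevY.mono fun y hy => hpx _ hy)
  have hyx : HasDerivAt (fun x => py f x z.2) (fderiv ℝ (fderiv ℝ F) z (1, 0) (0, 1)) z.1 := by
    have h : HasDerivAt (fun x => fderiv ℝ F (x, z.2) (0, 1))
        (fderiv ℝ (fderiv ℝ F) z (1, 0) (0, 1)) z.1 := by
      have h1 := hG'.comp_hasDerivAt z.1 (hlineX z)
      simpa using h1.clm_apply (hasDerivAt_const z.1 ((0 : ℝ), (1 : ℝ)))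
    exact h.congr_of_eventuallyEq (hevX.mono fun x hx => hpy _ hx)
  have hpxy : pxy f z.1 z.2 = fderiv ℝ (fderiv ℝ F) z (0, 1) (1, 0) := hxy.deriv
  have hev : ∀ᶠ p in 𝓝 z, p ∈ U := hU.mem_nhds hz
  refine ⟨?_, ?_, hpxy ▸ hxy, (hpxy.trans hsymm.symm) ▸ hyx, ?_, ?_⟩
  · convert hd z hz using 1
    rw [hpx z hz, hpy z hz]
    ext <;> simp
  · rw [hpy z hz]; exact hY z hz
  · exact (hG.continuousAt.clm_apply continuousAt_const).congr
      (hev.mono fun p hp => (hpx p hp).symm)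
  · exact (hG.continuousAt.clm_apply continuousAt_const).congr
      (hev.mono fun p hp => (hpy p hp).symm)

/-- Contraction argument for the Goursat-type inequality on a small rectangle: a function with
vanishing first-order data on a curve that is a graph over both axes vanishes. -/
theorem eq_zero_of_norm_mixedDeriv_le {E : Type*} [NormedAddCommGroup E] [NormedSpace ℝ E]
    {X Y : ℝ → ℝ} {T : Set ℝ} (hTc : IsCompact T) (hTp : T.OrdConnected)
    (hX : ContinuousOn X T) (hY : ContinuousOn Y T) {K η : ℝ} (hK : 0 ≤ K) (hη : η ≤ 1 / 2)
    (hKη : K * η ≤ 1 / 2) (hXη : ∀ s ∈ T, ∀ t ∈ T, |X s - X t| ≤ η)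
    (hYη : ∀ s ∈ T, ∀ t ∈ T, |Y s - Y t| ≤ η) {w a b c : ℝ × ℝ → E}
    (hw : ContinuousOn w ((X '' T) ×ˢ (Y '' T))) (ha : ContinuousOn a ((X '' T) ×ˢ (Y '' T)))
    (hb : ContinuousOn b ((X '' T) ×ˢ (Y '' T)))
    (hwy : ∀ p ∈ (X '' T) ×ˢ (Y '' T), HasDerivAt (fun y => w (p.1, y)) (b p) p.2)
    (hay : ∀ p ∈ (X '' T) ×ˢ (Y '' T), HasDerivAt (fun y => a (p.1, y)) (c p) p.2)
    (hbx : ∀ p ∈ (X '' T) ×ˢ (Y '' T), HasDerivAt (fun x => b (x, p.2)) (c p) p.1)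
    (hc : ∀ p ∈ (X '' T) ×ˢ (Y '' T), ‖c p‖ ≤ K * ‖(w p, a p, b p)‖)
    (h0 : ∀ s ∈ T, w (X s, Y s) = 0 ∧ a (X s, Y s) = 0 ∧ b (X s, Y s) = 0) :
    ∀ p ∈ (X '' T) ×ˢ (Y '' T), w p = 0 := by
  intro p₀ hp₀
  have hconv : ∀ Z : ℝ → ℝ, ContinuousOn Z T → Convex ℝ (Z '' T) := fun Z hZ =>
    ((hTp.isPreconnected).image Z hZ).ordConnected.convex
  obtain ⟨m, hm, hmax⟩ := ((hTc.image_of_continuousOn hX).prod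
    (hTc.image_of_continuousOn hY)).exists_isMaxOn ⟨p₀, hp₀⟩
    ((hw.prodMk (ha.prodMk hb)).norm)
  set M := ‖(w m, a m, b m)‖ with hM
  have hM0 : 0 ≤ M := norm_nonneg _
  have hle : ∀ p ∈ (X '' T) ×ˢ (Y '' T), ‖(w p, a p, b p)‖ ≤ M := fun p hp => hmax hp
  have hcM : ∀ p ∈ (X '' T) ×ˢ (Y '' T), ‖c p‖ ≤ K * M := fun p hp =>
    (hc p hp).trans (mul_le_mul_of_nonneg_left (hle p hp) hK)
  have hbM : ∀ p ∈ (X '' T) ×ˢ (Y '' T), ‖b p‖ ≤ M := fun p hp =>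
    ((norm_snd_le (a p, b p)).trans (norm_snd_le (w p, a p, b p))).trans (hle p hp)
  have hhalf : ∀ p ∈ (X '' T) ×ˢ (Y '' T), ‖(w p, a p, b p)‖ ≤ M / 2 := by
    rintro ⟨_, _⟩ ⟨⟨s, hs, rfl⟩, ⟨t, ht, rfl⟩⟩
    obtain ⟨hw0, ha0, -⟩ := h0 s hs
    obtain ⟨-, -, hb0⟩ := h0 t ht
    have h1 := (hconv Y hY).norm_image_sub_le_of_norm_hasDerivWithin_le (f := fun y => w (X s, y))
      (fun y hy => (hwy (X s, y) ⟨mem_image_of_mem X hs, hy⟩).hasDerivWithinAt)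
      (fun y hy => hbM (X s, y) ⟨mem_image_of_mem X hs, hy⟩)
      (mem_image_of_mem Y hs) (mem_image_of_mem Y ht)
    have h2 := (hconv Y hY).norm_image_sub_le_of_norm_hasDerivWithin_le (f := fun y => a (X s, y))
      (fun y hy => (hay (X s, y) ⟨mem_image_of_mem X hs, hy⟩).hasDerivWithinAt)
      (fun y hy => hcM (X s, y) ⟨mem_image_of_mem X hs, hy⟩)
      (mem_image_of_mem Y hs) (mem_image_of_mem Y ht)
    have h3 := (hconv X hX).norm_image_sub_le_of_norm_hasDerivWithin_le (f := fun x => b (x, Y t))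
      (fun x hx => (hbx (x, Y t) ⟨hx, mem_image_of_mem Y ht⟩).hasDerivWithinAt)
      (fun x hx => hcM (x, Y t) ⟨hx, mem_image_of_mem Y ht⟩)
      (mem_image_of_mem X ht) (mem_image_of_mem X hs)
    rw [hw0, sub_zero, Real.norm_eq_abs] at h1
    rw [ha0, sub_zero, Real.norm_eq_abs] at h2
    rw [hb0, sub_zero, Real.norm_eq_abs] at h3
    have hKM : 0 ≤ K * M := mul_nonneg hK hM0
    have e1 := mul_le_mul_of_nonneg_left (hYη t ht s hs) hM0
    have e2 := mul_le_mul_of_nonneg_left (hYη t ht s hs) hKM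
    have e3 := mul_le_mul_of_nonneg_left (hXη s hs t ht) hKM
    have e4 := mul_le_mul_of_nonneg_left hη hM0
    have e5 := mul_le_mul_of_nonneg_left hKη hM0
    refine max_le ?_ (max_le ?_ ?_)
    · dsimp only; linarith
    · dsimp only; linarith
    · dsimp only; linarith
  have hM1 : M ≤ M / 2 := hhalf m hm
  have h4 : ‖w p₀‖ ≤ M := (norm_fst_le (w p₀, a p₀, b p₀)).trans (hle p₀ hp₀)
  exact norm_le_zero_iff.1 (by linarith)

theorem exists_smooth_inverse {I : Set ℝ} (hI : IsOpen I) (hI' : I.OrdConnected) {X : ℝ → ℝ}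
    (hX : ContDiffOn ℝ (⊤ : ℕ∞) X I) (hX' : ∀ s ∈ I, deriv X s ≠ 0) :
    ∃ σ : ℝ → ℝ, IsOpen (X '' I) ∧ ContDiffOn ℝ (⊤ : ℕ∞) σ (X '' I) ∧
      ∀ s ∈ I, σ (X s) = s ∧ HasDerivAt σ (deriv X s)⁻¹ (X s) := by
  have hinj : InjOn X I := by
    have key : ∀ s ∈ I, ∀ t ∈ I, s < t → X s ≠ X t := by
      intro s hs t ht hst heq
      obtain ⟨r, hr, hr0⟩ := exists_deriv_eq_zero hst (hX.continuousOn.mono (hI'.out hs ht)) heq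
      exact hX' r (hI'.out hs ht (Ioo_subset_Icc_self hr)) hr0
    intro s hs t ht heq
    rcases lt_trichotomy s t with h | h | h
    · exact absurd heq (key s hs t ht h)
    · exact h
    · exact absurd heq.symm (key t ht s hs h)
  have hat : ∀ s ∈ I, ContDiffAt ℝ (⊤ : ℕ∞) X s := fun s hs => hX.contDiffAt (hI.mem_nhds hs)
  have hder : ∀ s ∈ I, HasStrictDerivAt X (deriv X s) s := fun s hs =>
    (hat s hs).hasStrictDerivAt (by simp)
  have hopen : IsOpenMap (I.domRestrict X) := by
    refine IsOpenMap.of_nhds_le fun ⟨s, hs⟩ => ?_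
    have h1 : Filter.map (I.domRestrict X) (𝓝 ⟨s, hs⟩) = Filter.map X (𝓝 s) := by
      rw [Set.domRestrict_eq, ← Filter.map_map, map_nhds_subtype_coe_eq_nhds hs (hI.mem_nhds hs)]
    rw [h1, (hder s hs).map_nhds_eq (hX' s hs)]
    exact le_rfl
  set e := OpenPartialHomeomorph.ofContinuousOpenRestrict (hinj.toPartialEquiv X I)
    hX.continuousOn hopen hI with he
  have hleft : ∀ s ∈ I, e.symm (X s) = s := fun s hs => e.left_inv hs
  have hmem : ∀ s ∈ I, X s ∈ e.target := fun s hs => mem_image_of_mem X hs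
  have hsm : ∀ s ∈ I, ContDiffAt ℝ (⊤ : ℕ∞) e.symm (X s) := fun s hs =>
    e.contDiffAt_symm_deriv (hX' s hs) (hmem s hs)
      (by rw [hleft s hs]; exact (hder s hs).hasDerivAt) (by rw [hleft s hs]; exact hat s hs)
  refine ⟨e.symm, e.open_target, ?_, fun s hs => ⟨hleft s hs, ?_⟩⟩
  · rintro _ ⟨s, hs, rfl⟩
    exact (hsm s hs).contDiffWithinAt
  · refine e.hasDerivAt_symm (hmem s hs) (hX' s hs) ?_
    rw [hleft s hs]; exact (hder s hs).hasDerivAt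

theorem partials_along_curve {f : ℝ → ℝ → ℝ} {U : Set (ℝ × ℝ)} (hU : IsOpen U)
    (hf : ContDiffOn ℝ 2 (fun p : ℝ × ℝ => f p.1 p.2) U) {I : Set ℝ} (hI : IsOpen I)
    {γ : ℝ → ℝ × ℝ} {s : ℝ} (hs : s ∈ I) (hγU : γ s ∈ U) (hγ : DifferentiableAt ℝ γ s)
    {φ : ℝ → ℝ} (hφ : ∀ r ∈ I, f (γ r).1 (γ r).2 = φ r) :
    px f (γ s).1 (γ s).2 * deriv (fun r => (γ r).1) s +
      py f (γ s).1 (γ s).2 * deriv (fun r => (γ r).2) s = deriv φ s := by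
  have h1 := (hasDerivAt_partials hU hf hγU).1
  have h2 : HasDerivAt γ (deriv (fun r => (γ r).1) s, deriv (fun r => (γ r).2) s) s :=
    hγ.fst.hasDerivAt.prodMk hγ.snd.hasDerivAt
  have h3 := HasFDerivAt.comp_hasDerivAt (l := fun p : ℝ × ℝ => f p.1 p.2) (f := γ) s h1 h2
  have h4 : HasDerivAt φ _ s := h3.congr_of_eventuallyEq
    (Filter.eventually_of_mem (hI.mem_nhds hs) fun r hr => (hφ r hr).symm)
  simpa using h4.deriv.symm

theorem partials_eq_of_cauchy_data_eq {f₁ f₂ : ℝ → ℝ → ℝ} {U₁ U₂ : Set (ℝ × ℝ)}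
    (hU₁ : IsOpen U₁) (hU₂ : IsOpen U₂)
    (hf₁ : ContDiffOn ℝ 2 (fun p : ℝ × ℝ => f₁ p.1 p.2) U₁)
    (hf₂ : ContDiffOn ℝ 2 (fun p : ℝ × ℝ => f₂ p.1 p.2) U₂) {I : Set ℝ} (hI : IsOpen I)
    {γ : ℝ → ℝ × ℝ} {s : ℝ} (hs : s ∈ I) (h₁ : γ s ∈ U₁) (h₂ : γ s ∈ U₂)
    (hγ : DifferentiableAt ℝ γ s) (hx' : deriv (fun r => (γ r).1) s ≠ 0) {φ : ℝ → ℝ}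
    (hφ₁ : ∀ r ∈ I, f₁ (γ r).1 (γ r).2 = φ r) (hφ₂ : ∀ r ∈ I, f₂ (γ r).1 (γ r).2 = φ r)
    (hn : normalDeriv f₁ γ s = normalDeriv f₂ γ s) :
    px f₁ (γ s).1 (γ s).2 = px f₂ (γ s).1 (γ s).2 ∧
      py f₁ (γ s).1 (γ s).2 = py f₂ (γ s).1 (γ s).2 := by
  have e₁ := partials_along_curve hU₁ hf₁ hI hs h₁ hγ hφ₁
  have e₂ := partials_along_curve hU₂ hf₂ hI hs h₂ hγ hφ₂
  unfold normalDeriv at hn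
  set a := deriv (fun r => (γ r).1) s
  set b := deriv (fun r => (γ r).2) s
  have hpos : 0 < a ^ 2 + b ^ 2 := by positivity
  have hsq : Real.sqrt (a ^ 2 + b ^ 2) ≠ 0 := (Real.sqrt_pos.2 hpos).ne'
  rw [div_left_inj' hsq] at hn
  constructor
  · refine mul_right_cancel₀ hpos.ne' ?_
    linear_combination a * (e₁ - e₂) - b * hn
  · refine mul_right_cancel₀ hpos.ne' ?_
    linear_combination b * (e₁ - e₂) + a * hn

/-- The right-hand side of the wave map system solved for the mixed derivatives, as a function of
`(u, v)`, `(u_x, v_x)`, `(u_y, v_y)`. -/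
noncomputable def waveMapRHS (z : (ℝ × ℝ) × (ℝ × ℝ) × (ℝ × ℝ)) : ℝ × ℝ :=
  (-(z.2.1.1 * z.2.2.1 / (2 * (1 + Real.exp ((z.1.1 + z.1.2) / 2)))),
    -(z.2.1.2 * z.2.2.2 / (2 * (1 + Real.exp ((z.1.1 + z.1.2) / 2)))))

theorem contDiff_waveMapRHS : ContDiff ℝ 1 waveMapRHS := by
  have h : ∀ z : (ℝ × ℝ) × (ℝ × ℝ) × (ℝ × ℝ),
      2 * (1 + Real.exp ((z.1.1 + z.1.2) / 2)) ≠ 0 := fun z => by positivity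
  unfold waveMapRHS
  fun_prop (disch := exact h _)

/-- The first-order jet `((u, v), (u_x, v_x), (u_y, v_y))`. -/
noncomputable def jet (u v : ℝ → ℝ → ℝ) (p : ℝ × ℝ) : (ℝ × ℝ) × (ℝ × ℝ) × (ℝ × ℝ) :=
  ((u p.1 p.2, v p.1 p.2), (px u p.1 p.2, px v p.1 p.2), (py u p.1 p.2, py v p.1 p.2))

theorem IsWaveMap.pxy_eq {U : Set (ℝ × ℝ)} {u v : ℝ → ℝ → ℝ} (h : IsWaveMap U u v) {p : ℝ × ℝ}
    (hp : p ∈ U) : (pxy u p.1 p.2, pxy v p.1 p.2) = waveMapRHS (jet u v p) := by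
  obtain ⟨h1, h2⟩ := h p hp
  exact Prod.ext (eq_neg_of_add_eq_zero_left h1) (eq_neg_of_add_eq_zero_left h2)

theorem continuousAt_jet {U : Set (ℝ × ℝ)} (hU : IsOpen U) {u v : ℝ → ℝ → ℝ}
    (hu : ContDiffOn ℝ 2 (fun p : ℝ × ℝ => u p.1 p.2) U)
    (hv : ContDiffOn ℝ 2 (fun p : ℝ × ℝ => v p.1 p.2) U) {p : ℝ × ℝ} (hp : p ∈ U) :
    ContinuousAt (jet u v) p := by
  obtain ⟨hu1, -, -, -, hu2, hu3⟩ := hasDerivAt_partials hU hu hp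
  obtain ⟨hv1, -, -, -, hv2, hv3⟩ := hasDerivAt_partials hU hv hp
  exact (hu1.continuousAt.prodMk hv1.continuousAt).prodMk
    ((hu2.prodMk hv2).prodMk (hu3.prodMk hv3))

theorem IsWaveMap.eq_near_of_jet_eq {I : Set ℝ} (hI : IsOpen I)
    {γ : ℝ → ℝ × ℝ} (hγ : ContDiffOn ℝ (⊤ : ℕ∞) γ I)
    (hx' : ∀ s ∈ I, deriv (fun r => (γ r).1) s ≠ 0)
    (hy' : ∀ s ∈ I, deriv (fun r => (γ r).2) s ≠ 0) {U : Set (ℝ × ℝ)} (hU : IsOpen U)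
    {u₁ v₁ u₂ v₂ : ℝ → ℝ → ℝ}
    (hu₁ : ContDiffOn ℝ 2 (fun p : ℝ × ℝ => u₁ p.1 p.2) U)
    (hv₁ : ContDiffOn ℝ 2 (fun p : ℝ × ℝ => v₁ p.1 p.2) U)
    (hu₂ : ContDiffOn ℝ 2 (fun p : ℝ × ℝ => u₂ p.1 p.2) U)
    (hv₂ : ContDiffOn ℝ 2 (fun p : ℝ × ℝ => v₂ p.1 p.2) U)
    (h₁ : IsWaveMap U u₁ v₁) (h₂ : IsWaveMap U u₂ v₂)
    (hjet : ∀ s ∈ I, jet u₁ v₁ (γ s) = jet u₂ v₂ (γ s)) {s₀ : ℝ} (hs₀ : s₀ ∈ I)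
    (hs₀U : γ s₀ ∈ U) :
    ∃ W : Set (ℝ × ℝ), IsOpen W ∧ γ s₀ ∈ W ∧ W ⊆ U ∧
      ∀ p ∈ W, u₁ p.1 p.2 = u₂ p.1 p.2 ∧ v₁ p.1 p.2 = v₂ p.1 p.2 := by
  set X : ℝ → ℝ := fun r => (γ r).1
  set Y : ℝ → ℝ := fun r => (γ r).2
  have hX : ContDiffOn ℝ (⊤ : ℕ∞) X I := hγ.fst
  have hY : ContDiffOn ℝ (⊤ : ℕ∞) Y I := hγ.snd
  obtain ⟨K, t, ht, hK⟩ :=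
    contDiff_waveMapRHS.contDiffAt (x := jet u₁ v₁ (γ s₀)).exists_lipschitzOnWith
  have hev : ∀ᶠ p in 𝓝 (X s₀, Y s₀), p ∈ U ∧ jet u₁ v₁ p ∈ t ∧ jet u₂ v₂ p ∈ t :=
    (hU.eventually_mem hs₀U).and (((continuousAt_jet hU hu₁ hv₁ hs₀U).eventually_mem ht).and
      ((continuousAt_jet hU hu₂ hv₂ hs₀U).eventually_mem (hjet s₀ hs₀ ▸ ht)))
  obtain ⟨A, hA, B, hB, hAB⟩ := mem_nhds_prod_iff.1 hev
  set η : ℝ := min (1 / 2) (1 / (2 * (K + 1))) with hη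
  have hη0 : 0 < η := lt_min (by norm_num) (by positivity)
  have hKη : (K : ℝ) * η ≤ 1 / 2 := by
    calc (K : ℝ) * η ≤ K * (1 / (2 * (K + 1))) :=
          mul_le_mul_of_nonneg_left (min_le_right _ _) K.2
      _ ≤ 1 / 2 := by
        rw [mul_one_div, div_le_div_iff₀ (by positivity) (by norm_num)]
        linarith
  have hXc : ContinuousAt X s₀ := hX.continuousOn.continuousAt (hI.mem_nhds hs₀)
  have hYc : ContinuousAt Y s₀ := hY.continuousOn.continuousAt (hI.mem_nhds hs₀)
  have hevs : ∀ᶠ s in 𝓝 s₀, s ∈ I ∧ X s ∈ A ∧ Y s ∈ B ∧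
      X s ∈ Metric.ball (X s₀) (η / 2) ∧ Y s ∈ Metric.ball (Y s₀) (η / 2) :=
    (hI.eventually_mem hs₀).and ((hXc.eventually_mem hA).and ((hYc.eventually_mem hB).and
      ((hXc.eventually_mem (Metric.ball_mem_nhds _ (by positivity))).and
        (hYc.eventually_mem (Metric.ball_mem_nhds _ (by positivity))))))
  obtain ⟨ε, hε, hball⟩ := Metric.eventually_nhds_iff_ball.1 hevs
  set T := Icc (s₀ - ε / 2) (s₀ + ε / 2)
  set T' := Ioo (s₀ - ε / 2) (s₀ + ε / 2)
  have hT : ∀ s ∈ T, s ∈ I ∧ X s ∈ A ∧ Y s ∈ B ∧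
      X s ∈ Metric.ball (X s₀) (η / 2) ∧ Y s ∈ Metric.ball (Y s₀) (η / 2) := fun s hs =>
    hball s (by rw [Metric.mem_ball, Real.dist_eq, abs_lt]; constructor <;> linarith [hs.1, hs.2])
  have hTI : T ⊆ I := fun s hs => (hT s hs).1
  have hT'I : T' ⊆ I := Ioo_subset_Icc_self.trans hTI
  have hmem : s₀ ∈ T' := ⟨by linarith, by linarith⟩
  have hR : ∀ p ∈ (X '' T) ×ˢ (Y '' T), p ∈ U ∧ jet u₁ v₁ p ∈ t ∧ jet u₂ v₂ p ∈ t := by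
    rintro ⟨_, _⟩ ⟨⟨s, hs, rfl⟩, ⟨r, hr, rfl⟩⟩
    exact hAB ⟨(hT s hs).2.1, (hT r hr).2.2.1⟩
  have hclose : ∀ {x y z : ℝ}, x ∈ Metric.ball z (η / 2) → y ∈ Metric.ball z (η / 2) →
      |x - y| ≤ η := fun {x y z} hx hy => by
    have h := dist_triangle_right x y z
    rw [Metric.mem_ball] at hx hy
    rw [← Real.dist_eq]; linarith
  have hjc : ContinuousOn (fun p => jet u₁ v₁ p - jet u₂ v₂ p) ((X '' T) ×ˢ (Y '' T)) :=
    fun p hp => ((continuousAt_jet hU hu₁ hv₁ (hR p hp).1).sub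
      (continuousAt_jet hU hu₂ hv₂ (hR p hp).1)).continuousWithinAt
  have hzero := eq_zero_of_norm_mixedDeriv_le (X := X) (Y := Y) (T := T) isCompact_Icc
    ordConnected_Icc (hX.continuousOn.mono hTI) (hY.continuousOn.mono hTI) K.2 (min_le_left _ _)
    hKη (fun s hs r hr => hclose (hT s hs).2.2.2.1 (hT r hr).2.2.2.1)
    (fun s hs r hr => hclose (hT s hs).2.2.2.2 (hT r hr).2.2.2.2)
    (w := fun p => (jet u₁ v₁ p - jet u₂ v₂ p).1)
    (a := fun p => (jet u₁ v₁ p - jet u₂ v₂ p).2.1)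
    (b := fun p => (jet u₁ v₁ p - jet u₂ v₂ p).2.2)
    (c := fun p => waveMapRHS (jet u₁ v₁ p) - waveMapRHS (jet u₂ v₂ p))
    hjc.fst hjc.snd.fst hjc.snd.snd
    (fun p hp =>
      (((hasDerivAt_partials hU hu₁ (hR p hp).1).2.1.prodMk
        (hasDerivAt_partials hU hv₁ (hR p hp).1).2.1).sub
      ((hasDerivAt_partials hU hu₂ (hR p hp).1).2.1.prodMk
        (hasDerivAt_partials hU hv₂ (hR p hp).1).2.1)))
    (fun p hp => by
      rw [← h₁.pxy_eq (hR p hp).1, ← h₂.pxy_eq (hR p hp).1]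
      exact (((hasDerivAt_partials hU hu₁ (hR p hp).1).2.2.1.prodMk
        (hasDerivAt_partials hU hv₁ (hR p hp).1).2.2.1).sub
      ((hasDerivAt_partials hU hu₂ (hR p hp).1).2.2.1.prodMk
        (hasDerivAt_partials hU hv₂ (hR p hp).1).2.2.1)))
    (fun p hp => by
      rw [← h₁.pxy_eq (hR p hp).1, ← h₂.pxy_eq (hR p hp).1]
      exact (((hasDerivAt_partials hU hu₁ (hR p hp).1).2.2.2.1.prodMk
        (hasDerivAt_partials hU hv₁ (hR p hp).1).2.2.2.1).sub
      ((hasDerivAt_partials hU hu₂ (hR p hp).1).2.2.2.1.prodMk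
        (hasDerivAt_partials hU hv₂ (hR p hp).1).2.2.2.1)))
    (fun p hp => hK.norm_sub_le (hR p hp).2.1 (hR p hp).2.2)
    (fun s hs => by
      have h : jet u₁ v₁ (X s, Y s) = jet u₂ v₂ (X s, Y s) := hjet s (hTI hs)
      simp [h])
  obtain ⟨-, hXo, -⟩ := exists_smooth_inverse isOpen_Ioo ordConnected_Ioo (hX.mono hT'I)
    fun s hs => hx' s (hT'I hs)
  obtain ⟨-, hYo, -⟩ := exists_smooth_inverse isOpen_Ioo ordConnected_Ioo (hY.mono hT'I)
    fun s hs => hy' s (hT'I hs)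
  have hsub : (X '' T') ×ˢ (Y '' T') ⊆ (X '' T) ×ˢ (Y '' T) :=
    prod_mono (image_mono Ioo_subset_Icc_self) (image_mono Ioo_subset_Icc_self)
  refine ⟨_, hXo.prod hYo, ⟨mem_image_of_mem X hmem, mem_image_of_mem Y hmem⟩,
    fun p hp => (hR p (hsub hp)).1, fun p hp => ?_⟩
  have h := hzero p (hsub hp)
  exact ⟨sub_eq_zero.1 (congrArg Prod.fst h), sub_eq_zero.1 (congrArg Prod.snd h)⟩

theorem hasDerivAt_integral_of_continuousOn {E : Type*} [NormedAddCommGroup E] [NormedSpace ℝ E]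
    [CompleteSpace E] {I : Set ℝ} (hI : IsOpen I) (hI' : I.OrdConnected) {f : ℝ → E}
    (hf : ContinuousOn f I) {s₀ s : ℝ} (hs₀ : s₀ ∈ I) (hs : s ∈ I) :
    HasDerivAt (fun r => ∫ t in s₀..r, f t) (f s) s :=
  intervalIntegral.integral_hasDerivAt_right
    ((hf.mono (hI'.uIcc_subset hs₀ hs)).intervalIntegrable)
    (hf.stronglyMeasurableAtFilter hI s hs) (hf.continuousAt (hI.mem_nhds hs))

/-- Picard iterates of the increments for the linear equation `Y' = A Y`. -/
noncomputable def picardTerm {E : Type*} [NormedAddCommGroup E] [NormedSpace ℝ E]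
    (A : ℝ → E →L[ℝ] E) (s₀ : ℝ) (y₀ : E) : ℕ → ℝ → E
  | 0 => fun _ => y₀
  | k + 1 => fun s => ∫ t in s₀..s, A t (picardTerm A s₀ y₀ k t)

theorem continuousOn_picardTerm {E : Type*} [NormedAddCommGroup E] [NormedSpace ℝ E]
    [CompleteSpace E] {I : Set ℝ} (hI : IsOpen I) (hI' : I.OrdConnected) {A : ℝ → E →L[ℝ] E}
    (hA : ContinuousOn A I) {s₀ : ℝ} (hs₀ : s₀ ∈ I) (y₀ : E) (k : ℕ) :
    ContinuousOn (picardTerm A s₀ y₀ k) I := by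
  induction k with
  | zero => exact continuousOn_const
  | succ k ih =>
    intro s hs
    exact (hasDerivAt_integral_of_continuousOn hI hI' (hA.clm_apply ih) hs₀
      hs).continuousAt.continuousWithinAt

theorem norm_picardTerm_le {E : Type*} [NormedAddCommGroup E] [NormedSpace ℝ E]
    {A : ℝ → E →L[ℝ] E} {s₀ : ℝ} (y₀ : E) {T : Set ℝ} (hT : T.OrdConnected) (hs₀ : s₀ ∈ T) {C : ℝ}
    (hC : ∀ t ∈ T, ‖A t‖ ≤ C) (k : ℕ) :
    ∀ s ∈ T, ‖picardTerm A s₀ y₀ k s‖ ≤ ‖y₀‖ * C ^ k / k.factorial * |s - s₀| ^ k := by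
  have hC0 : 0 ≤ C := (norm_nonneg _).trans (hC s₀ hs₀)
  induction k with
  | zero => intro s _; simp [picardTerm]
  | succ k ih =>
    intro s hs
    simp only [picardTerm]
    rw [intervalIntegral.norm_integral_eq_norm_integral_uIoc]
    have key : ∀ t ∈ Set.uIoc s₀ s, ‖A t (picardTerm A s₀ y₀ k t)‖ ≤
        C * (‖y₀‖ * C ^ k / k.factorial) * |t - s₀| ^ k := by
      intro t ht
      have htT : t ∈ T := hT.uIcc_subset hs₀ hs (Set.uIoc_subset_uIcc ht)
      calc _ ≤ ‖A t‖ * ‖picardTerm A s₀ y₀ k t‖ := (A t).le_opNorm _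
        _ ≤ C * (‖y₀‖ * C ^ k / k.factorial * |t - s₀| ^ k) :=
          mul_le_mul (hC t htT) (ih t htT) (norm_nonneg _) hC0
        _ = _ := by ring
    refine (MeasureTheory.norm_integral_le_of_norm_le
      (g := fun t => C * (‖y₀‖ * C ^ k / k.factorial) * |t - s₀| ^ k) ?_ ?_).trans ?_
    · exact (Continuous.integrableOn_uIoc (by fun_prop))
    · exact (MeasureTheory.ae_restrict_iff' measurableSet_uIoc).2 (Eventually.of_forall key)
    · rw [MeasureTheory.integral_const_mul, integral_pow_abs_sub_uIoc, Nat.factorial_succ]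
      push_cast
      apply le_of_eq
      field_simp
      ring

/-- A linear differential equation with continuous coefficients on an open interval
has a solution on the whole interval. -/
theorem exists_hasDerivAt_linear {E : Type*} [NormedAddCommGroup E] [NormedSpace ℝ E]
    [CompleteSpace E] {I : Set ℝ} (hI : IsOpen I) (hI' : I.OrdConnected) {A : ℝ → E →L[ℝ] E}
    (hA : ContinuousOn A I) {s₀ : ℝ} (hs₀ : s₀ ∈ I) (y₀ : E) :
    ∃ Y : ℝ → E, Y s₀ = y₀ ∧ ∀ s ∈ I, HasDerivAt Y (A s (Y s)) s := by
  set P := picardTerm A s₀ y₀ with hP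
  have hP0 : ∀ k, P (k + 1) s₀ = 0 := fun k => by simp [hP, picardTerm]
  refine ⟨fun s => y₀ + ∑' k, P (k + 1) s, by simp [hP0], fun s hs => ?_⟩
  obtain ⟨c, d, hcd, hsub⟩ : ∃ c d, (s ∈ Ioo c d ∧ s₀ ∈ Ioo c d) ∧ Icc c d ⊆ I := by
    have hmin : min s s₀ ∈ I := by rcases min_choice s s₀ with h | h <;> rw [h] <;> assumption
    have hmax : max s s₀ ∈ I := by rcases max_choice s s₀ with h | h <;> rw [h] <;> assumption
    obtain ⟨ε, hε, h1⟩ := Metric.isOpen_iff.1 hI _ hmin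
    obtain ⟨δ, hδ, h2⟩ := Metric.isOpen_iff.1 hI _ hmax
    refine ⟨min s s₀ - ε / 2, max s s₀ + δ / 2, ⟨⟨?_, ?_⟩, ⟨?_, ?_⟩⟩, hI'.out (h1 ?_) (h2 ?_)⟩
    · linarith [min_le_left s s₀]
    · linarith [le_max_left s s₀]
    · linarith [min_le_right s s₀]
    · linarith [le_max_right s s₀]
    · rw [Metric.mem_ball, Real.dist_eq, abs_lt]; constructor <;> linarith
    · rw [Metric.mem_ball, Real.dist_eq, abs_lt]; constructor <;> linarith
  obtain ⟨C, hC⟩ := isCompact_Icc.exists_bound_of_continuousOn (hA.mono hsub)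
  have hC0 : 0 ≤ C := (norm_nonneg _).trans (hC s₀ (Ioo_subset_Icc_self hcd.2))
  have hbound : ∀ k, ∀ t ∈ Ioo c d, ‖P k t‖ ≤ ‖y₀‖ * ((C * (d - c)) ^ k / k.factorial) := by
    intro k t ht
    refine (norm_picardTerm_le y₀ ordConnected_Icc (Ioo_subset_Icc_self hcd.2) hC k t
      (Ioo_subset_Icc_self ht)).trans ?_
    have h1 : |t - s₀| ≤ d - c := by
      rw [abs_le]; constructor <;> linarith [ht.1, ht.2, hcd.2.1, hcd.2.2]
    calc _ ≤ ‖y₀‖ * C ^ k / k.factorial * (d - c) ^ k := by gcongr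
      _ = _ := by rw [mul_pow]; ring
  have hsum : Summable fun k => ‖y₀‖ * ((C * (d - c)) ^ k / (k.factorial : ℝ)) :=
    (Real.summable_pow_div_factorial _).mul_left _
  have hder := hasDerivAt_tsum_of_isPreconnected (g := fun k => P (k + 1))
    (g' := fun k t => A t (P k t)) (u := fun k => C * (‖y₀‖ * ((C * (d - c)) ^ k / k.factorial)))
    (hsum.mul_left C) isOpen_Ioo isPreconnected_Ioo (y₀ := s₀) (y := s)
    (fun k t ht => hasDerivAt_integral_of_continuousOn hI hI'
      (hA.clm_apply (continuousOn_picardTerm hI hI' hA hs₀ y₀ k)) hs₀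
      (hsub (Ioo_subset_Icc_self ht)))
    (fun k t ht => ((A t).le_opNorm _).trans
      (mul_le_mul (hC t (Ioo_subset_Icc_self ht)) (hbound k t ht) (norm_nonneg _) hC0))
    hcd.2 (by simp [hP0, summable_zero]) hcd.1
  have hsP : Summable fun k => P k s := Summable.of_norm_bounded hsum fun k => hbound k s hcd.1
  have heq : A s (y₀ + ∑' k, P (k + 1) s) = ∑' k, A s (P k s) := by
    rw [← (A s).map_tsum hsP, hsP.tsum_eq_zero_add]; rfl
  rw [heq]
  exact hder.const_add y₀

theorem contDiffOn_of_hasDerivAt_linear {E : Type*} [NormedAddCommGroup E] [NormedSpace ℝ E]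
    {I : Set ℝ} (hI : IsOpen I) {A : ℝ → E →L[ℝ] E} (hA : ContDiffOn ℝ (⊤ : ℕ∞) A I) {Y : ℝ → E}
    (hY : ∀ s ∈ I, HasDerivAt Y (A s (Y s)) s) : ContDiffOn ℝ (⊤ : ℕ∞) Y I := by
  refine contDiffOn_infty.2 fun n => ?_
  induction n with
  | zero =>
    exact contDiffOn_zero.2 fun s hs => (hY s hs).continuousAt.continuousWithinAt
  | succ n ih =>
    push_cast
    rw [contDiffOn_succ_iff_deriv_of_isOpen hI]
    refine ⟨fun s hs => (hY s hs).differentiableAt.differentiableWithinAt, by simp, ?_⟩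
    exact ((hA.of_le (by exact_mod_cast le_top)).clm_apply ih).congr fun s hs => (hY s hs).deriv

/-- The system `f' = m₁ g`, `g' = m₂ f` with smooth coefficients on an open interval. -/
theorem exists_offDiagonal_system {I : Set ℝ} (hI : IsOpen I) (hI' : I.OrdConnected)
    {m₁ m₂ : ℝ → ℝ} (h₁ : ContDiffOn ℝ (⊤ : ℕ∞) m₁ I) (h₂ : ContDiffOn ℝ (⊤ : ℕ∞) m₂ I)
    {s₀ : ℝ} (hs₀ : s₀ ∈ I) (c d : ℝ) :
    ∃ f g : ℝ → ℝ, f s₀ = c ∧ g s₀ = d ∧ ContDiffOn ℝ (⊤ : ℕ∞) f I ∧ ContDiffOn ℝ (⊤ : ℕ∞) g I ∧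
      ∀ s ∈ I, HasDerivAt f (m₁ s * g s) s ∧ HasDerivAt g (m₂ s * f s) s := by
  set A : ℝ → (ℝ × ℝ →L[ℝ] ℝ × ℝ) := fun s =>
    m₁ s • (ContinuousLinearMap.inl ℝ ℝ ℝ ∘L ContinuousLinearMap.snd ℝ ℝ ℝ) +
    m₂ s • (ContinuousLinearMap.inr ℝ ℝ ℝ ∘L ContinuousLinearMap.fst ℝ ℝ ℝ) with hAdef
  have hA : ContDiffOn ℝ (⊤ : ℕ∞) A I :=
    (h₁.smul contDiffOn_const).add (h₂.smul contDiffOn_const)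
  have hAv : ∀ s z, A s z = (m₁ s * z.2, m₂ s * z.1) := fun s z => by
    simp [hAdef]
  obtain ⟨Y, hY0, hY⟩ := exists_hasDerivAt_linear hI hI' hA.continuousOn hs₀ (c, d)
  have hYs := contDiffOn_of_hasDerivAt_linear hI hA hY
  refine ⟨fun s => (Y s).1, fun s => (Y s).2, by simp [hY0], by simp [hY0], hYs.fst, hYs.snd,
    fun s hs => ?_⟩
  have h := hY s hs
  rw [hAv] at h
  exact ⟨h.fst, h.snd⟩

/-- If `p` and `q` are opposite entries of a factorized matrix with unit determinant, then
`u = 2 log p` solves the first wave map equation with `v = 2 log q`. -/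
theorem two_log_wave_equation {U : Set (ℝ × ℝ)} (hU : IsOpen U) {p q a b : ℝ → ℝ → ℝ}
    {μ ν : ℝ → ℝ} (hp : ∀ z ∈ U, 0 < p z.1 z.2) (hq : ∀ z ∈ U, 0 < q z.1 z.2)
    (hpx : ∀ z ∈ U, HasDerivAt (fun x => p x z.2) (μ z.1 * b z.1 z.2) z.1)
    (hpy : ∀ z ∈ U, HasDerivAt (fun y => p z.1 y) (a z.1 z.2 * ν z.2) z.2)
    (hby : ∀ z ∈ U, HasDerivAt (fun y => b z.1 y) (q z.1 z.2 * ν z.2) z.2)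
    (hdet : ∀ z ∈ U, a z.1 z.2 * b z.1 z.2 = 1 + p z.1 z.2 * q z.1 z.2) {z : ℝ × ℝ} (hz : z ∈ U) :
    px (fun x y => 2 * Real.log (p x y)) z.1 z.2 = 2 * (μ z.1 * b z.1 z.2 / p z.1 z.2) ∧
    py (fun x y => 2 * Real.log (p x y)) z.1 z.2 = 2 * (a z.1 z.2 * ν z.2 / p z.1 z.2) ∧
    pxy (fun x y => 2 * Real.log (p x y)) z.1 z.2 +
      px (fun x y => 2 * Real.log (p x y)) z.1 z.2 * py (fun x y => 2 * Real.log (p x y)) z.1 z.2 /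
        (2 * (1 + p z.1 z.2 * q z.1 z.2)) = 0 := by
  have hX : ∀ z ∈ U, px (fun x y => 2 * Real.log (p x y)) z.1 z.2 =
      2 * (μ z.1 * b z.1 z.2 / p z.1 z.2) := fun z hz =>
    (((hpx z hz).log (hp z hz).ne').const_mul 2).deriv
  have hY : py (fun x y => 2 * Real.log (p x y)) z.1 z.2 =
      2 * (a z.1 z.2 * ν z.2 / p z.1 z.2) :=
    (((hpy z hz).log (hp z hz).ne').const_mul 2).deriv
  have hevY : ∀ᶠ y in 𝓝 z.2, (z.1, y) ∈ U :=
    (Continuous.prodMk_right z.1).continuousAt.preimage_mem_nhds (hU.mem_nhds hz)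
  have hXY : pxy (fun x y => 2 * Real.log (p x y)) z.1 z.2 =
      2 * ((μ z.1 * (q z.1 z.2 * ν z.2) * p z.1 z.2 -
        μ z.1 * b z.1 z.2 * (a z.1 z.2 * ν z.2)) / p z.1 z.2 ^ 2) := by
    have h1 := ((((hby z hz).const_mul (μ z.1)).div (hpy z hz) (hp z hz).ne').const_mul 2)
    exact (h1.congr_of_eventuallyEq (hevY.mono fun y hy => hX (z.1, y) hy)).deriv
  refine ⟨hX z hz, hY, ?_⟩
  rw [hXY, hX z hz, hY]
  have h1 := hdet z hz
  have hp0 := hp z hz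
  have hq0 := hq z hz
  have hpos : 0 < 1 + p z.1 z.2 * q z.1 z.2 := by positivity
  field_simp
  linear_combination (-2 * μ z.1 * ν z.2 * (p z.1 z.2 * q z.1 z.2)) * h1

/-- Solution of the characteristic problem in matrix form: the matrix `!![a, p; q, b]` factorizes
as `L(s) R(t)` with `L' L⁻¹` and `R⁻¹ R'` off-diagonal, and has prescribed first-order data for
`p`, `q` on the diagonal `s = t`. -/
theorem exists_factorized_matrix {I : Set ℝ} (hI : IsOpen I) (hI' : I.OrdConnected)
    {s₀ : ℝ} (hs₀ : s₀ ∈ I) {P Q ps pt qs qt : ℝ → ℝ}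
    (hP : ContDiffOn ℝ (⊤ : ℕ∞) P I) (hQ : ContDiffOn ℝ (⊤ : ℕ∞) Q I)
    (hps : ContDiffOn ℝ (⊤ : ℕ∞) ps I)
    (hqs : ContDiffOn ℝ (⊤ : ℕ∞) qs I) (hqt : ContDiffOn ℝ (⊤ : ℕ∞) qt I)
    (hP0 : ∀ s ∈ I, 0 < P s) (hQ0 : ∀ s ∈ I, 0 < Q s)
    (hP' : ∀ s ∈ I, HasDerivAt P (ps s + pt s) s) (hQ' : ∀ s ∈ I, HasDerivAt Q (qs s + qt s) s) :
    ∃ (p q a b : ℝ → ℝ → ℝ) (m₁ m₂ n₁ n₂ : ℝ → ℝ),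
      ContDiffOn ℝ (⊤ : ℕ∞) (fun z : ℝ × ℝ => p z.1 z.2) (I ×ˢ I) ∧
      ContDiffOn ℝ (⊤ : ℕ∞) (fun z : ℝ × ℝ => q z.1 z.2) (I ×ˢ I) ∧
      (∀ s ∈ I, ∀ t ∈ I,
        HasDerivAt (fun x => p x t) (m₁ s * b s t) s ∧
        HasDerivAt (fun y => p s y) (a s t * n₁ t) t ∧
        HasDerivAt (fun x => q x t) (m₂ s * a s t) s ∧
        HasDerivAt (fun y => q s y) (b s t * n₂ t) t ∧
        HasDerivAt (fun y => a s y) (p s t * n₂ t) t ∧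
        HasDerivAt (fun y => b s y) (q s t * n₁ t) t ∧
        a s t * b s t = 1 + p s t * q s t) ∧
      ∀ s ∈ I, p s s = P s ∧ q s s = Q s ∧ m₁ s * b s s = ps s ∧ a s s * n₁ s = pt s ∧
        m₂ s * a s s = qs s ∧ b s s * n₂ s = qt s := by
  have hD : ∀ s ∈ I, 1 + P s * Q s ≠ 0 := fun s hs => by
    have := hP0 s hs
    have := hQ0 s hs
    positivity
  set κ : ℝ → ℝ := fun s => (Q s * ps s + P s * qt s) / (1 + P s * Q s) with hκdef
  have hDs : ContDiffOn ℝ (⊤ : ℕ∞) (fun s => 1 + P s * Q s) I := contDiffOn_const.add (hP.mul hQ)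
  have hκ : ContDiffOn ℝ (⊤ : ℕ∞) κ I := ((hQ.mul hps).add (hP.mul hqt)).div hDs hD
  set α : ℝ → ℝ := fun s => Real.exp (∫ r in s₀..s, κ r)
  have hα' : ∀ s ∈ I, HasDerivAt α (κ s * α s) s := fun s hs => by
    have h := (hasDerivAt_integral_of_continuousOn hI hI' hκ.continuousOn hs₀ hs).exp
    rwa [mul_comm] at h
  have hα : ContDiffOn ℝ (⊤ : ℕ∞) α I :=
    contDiffOn_of_hasDerivAt_linear hI (A := fun s => κ s • ContinuousLinearMap.id ℝ ℝ)
      (hκ.smul contDiffOn_const) (fun s hs => by simpa using hα' s hs)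
  have hα0 : ∀ s, α s ≠ 0 := fun s => (Real.exp_pos _).ne'
  set β : ℝ → ℝ := fun s => (1 + P s * Q s) / α s with hβdef
  have hβ : ContDiffOn ℝ (⊤ : ℕ∞) β I := hDs.div hα fun s _ => hα0 s
  have hβ0 : ∀ s ∈ I, β s ≠ 0 := fun s hs => div_ne_zero (hD s hs) (hα0 s)
  have hαβ : ∀ s, α s * β s = 1 + P s * Q s := fun s => mul_div_cancel₀ _ (hα0 s)
  set m₁ : ℝ → ℝ := fun s => ps s / β s with hm₁def
  set m₂ : ℝ → ℝ := fun s => qs s / α s with hm₂def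
  set n₁ : ℝ → ℝ := fun s => pt s / α s with hn₁def
  set n₂ : ℝ → ℝ := fun s => qt s / β s with hn₂def
  have hm₁ : ContDiffOn ℝ (⊤ : ℕ∞) m₁ I := hps.div hβ hβ0
  have hm₂ : ContDiffOn ℝ (⊤ : ℕ∞) m₂ I := hqs.div hα fun s _ => hα0 s
  have em₁ : ∀ s ∈ I, m₁ s * β s = ps s := fun s hs => div_mul_cancel₀ _ (hβ0 s hs)
  have em₂ : ∀ s ∈ I, m₂ s * α s = qs s := fun s hs => div_mul_cancel₀ _ (hα0 s)
  have en₁ : ∀ s ∈ I, α s * n₁ s = pt s := fun s hs => mul_div_cancel₀ _ (hα0 s)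
  have en₂ : ∀ s ∈ I, β s * n₂ s = qt s := fun s hs => mul_div_cancel₀ _ (hβ0 s hs)
  have hα'' : ∀ s ∈ I, HasDerivAt α (m₁ s * Q s + P s * n₂ s) s := fun s hs => by
    convert hα' s hs using 1
    have := hβ0 s hs
    refine mul_right_cancel₀ this ?_
    have e : κ s * (1 + P s * Q s) = Q s * ps s + P s * qt s := div_mul_cancel₀ _ (hD s hs)
    linear_combination Q s * em₁ s hs + P s * en₂ s hs - κ s * hαβ s - e
  have hβ' : ∀ s ∈ I, HasDerivAt β (m₂ s * P s + Q s * n₁ s) s := fun s hs => by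
    have h := (((hP' s hs).mul (hQ' s hs)).const_add 1).div (hα'' s hs) (hα0 s)
    refine h.congr_deriv ?_
    rw [div_eq_iff (pow_ne_zero 2 (hα0 s)), Pi.mul_apply]
    linear_combination (m₁ s * Q s + P s * n₂ s) * hαβ s - (α s * P s) * em₂ s hs -
      (α s * Q s) * en₁ s hs - α s * Q s * em₁ s hs - α s * P s * en₂ s hs
  obtain ⟨l₁₁, l₂₁, i₁, i₂, c₁₁, c₂₁, d₁⟩ := exists_offDiagonal_system hI hI' hm₁ hm₂ hs₀ 1 0
  obtain ⟨l₁₂, l₂₂, i₃, i₄, c₁₂, c₂₂, d₂⟩ := exists_offDiagonal_system hI hI' hm₁ hm₂ hs₀ 0 1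
  have hdet : ∀ s ∈ I, l₁₁ s * l₂₂ s - l₁₂ s * l₂₁ s = 1 := by
    have hder : ∀ s ∈ I, HasDerivAt (fun s => l₁₁ s * l₂₂ s - l₁₂ s * l₂₁ s) 0 s := fun s hs => by
      have h := ((d₁ s hs).1.mul (d₂ s hs).2).sub ((d₂ s hs).1.mul (d₁ s hs).2)
      exact h.congr_deriv (by ring)
    intro s hs
    have h := hI.is_const_of_deriv_eq_zero hI'.isPreconnected
      (fun r hr => (hder r hr).differentiableAt.differentiableWithinAt)
      (fun r hr => (hder r hr).deriv) hs hs₀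
    rw [h, i₁, i₂, i₃, i₄]; ring
  set r₁₁ : ℝ → ℝ := fun s => l₂₂ s * α s - l₁₂ s * Q s with hr₁₁
  set r₁₂ : ℝ → ℝ := fun s => l₂₂ s * P s - l₁₂ s * β s with hr₁₂
  set r₂₁ : ℝ → ℝ := fun s => l₁₁ s * Q s - l₂₁ s * α s with hr₂₁
  set r₂₂ : ℝ → ℝ := fun s => l₁₁ s * β s - l₂₁ s * P s with hr₂₂
  have hPd : ∀ s ∈ I, HasDerivAt P (m₁ s * β s + α s * n₁ s) s := fun s hs => by
    rw [em₁ s hs, en₁ s hs]; exact hP' s hs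
  have hQd : ∀ s ∈ I, HasDerivAt Q (m₂ s * α s + β s * n₂ s) s := fun s hs => by
    rw [em₂ s hs, en₂ s hs]; exact hQ' s hs
  have dr₁₁ : ∀ t ∈ I, HasDerivAt r₁₁ (r₁₂ t * n₂ t) t := fun t ht => by
    convert! ((d₂ t ht).2.mul (hα'' t ht)).sub ((d₂ t ht).1.mul (hQd t ht)) using 1
    simp only [hr₁₂]; ring
  have dr₁₂ : ∀ t ∈ I, HasDerivAt r₁₂ (r₁₁ t * n₁ t) t := fun t ht => by
    convert! ((d₂ t ht).2.mul (hPd t ht)).sub ((d₂ t ht).1.mul (hβ' t ht)) using 1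
    simp only [hr₁₁]; ring
  have dr₂₁ : ∀ t ∈ I, HasDerivAt r₂₁ (r₂₂ t * n₂ t) t := fun t ht => by
    convert! ((d₁ t ht).1.mul (hQd t ht)).sub ((d₁ t ht).2.mul (hα'' t ht)) using 1
    simp only [hr₂₂]; ring
  have dr₂₂ : ∀ t ∈ I, HasDerivAt r₂₂ (r₂₁ t * n₁ t) t := fun t ht => by
    convert! ((d₁ t ht).1.mul (hβ' t ht)).sub ((d₁ t ht).2.mul (hPd t ht)) using 1
    simp only [hr₂₁]; ring
  have hfst : ∀ {f : ℝ → ℝ}, ContDiffOn ℝ (⊤ : ℕ∞) f I →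
      ContDiffOn ℝ (⊤ : ℕ∞) (fun z : ℝ × ℝ => f z.1) (I ×ˢ I) := fun {f} hf =>
    hf.comp contDiffOn_fst fun z hz => hz.1
  have hsnd : ∀ {f : ℝ → ℝ}, ContDiffOn ℝ (⊤ : ℕ∞) f I →
      ContDiffOn ℝ (⊤ : ℕ∞) (fun z : ℝ × ℝ => f z.2) (I ×ˢ I) := fun {f} hf =>
    hf.comp contDiffOn_snd fun z hz => hz.2
  have cr₁₁ : ContDiffOn ℝ (⊤ : ℕ∞) r₁₁ I := (c₂₂.mul hα).sub (c₁₂.mul hQ)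
  have cr₁₂ : ContDiffOn ℝ (⊤ : ℕ∞) r₁₂ I := (c₂₂.mul hP).sub (c₁₂.mul hβ)
  have cr₂₁ : ContDiffOn ℝ (⊤ : ℕ∞) r₂₁ I := (c₁₁.mul hQ).sub (c₂₁.mul hα)
  have cr₂₂ : ContDiffOn ℝ (⊤ : ℕ∞) r₂₂ I := (c₁₁.mul hβ).sub (c₂₁.mul hP)
  have hdiag : ∀ s ∈ I, l₁₁ s * r₁₂ s + l₁₂ s * r₂₂ s = P s ∧
      l₂₁ s * r₁₁ s + l₂₂ s * r₂₁ s = Q s ∧ l₁₁ s * r₁₁ s + l₁₂ s * r₂₁ s = α s ∧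
      l₂₁ s * r₁₂ s + l₂₂ s * r₂₂ s = β s := fun s hs => by
    simp only [hr₁₁, hr₁₂, hr₂₁, hr₂₂]
    exact ⟨by linear_combination P s * hdet s hs, by linear_combination Q s * hdet s hs,
      by linear_combination α s * hdet s hs, by linear_combination β s * hdet s hs⟩
  have hdetR : ∀ t ∈ I, r₁₁ t * r₂₂ t - r₁₂ t * r₂₁ t = 1 := fun t ht => by
    simp only [hr₁₁, hr₁₂, hr₂₁, hr₂₂]
    linear_combination (α t * β t - P t * Q t) * hdet t ht + hαβ t
  refine ⟨fun s t => l₁₁ s * r₁₂ t + l₁₂ s * r₂₂ t, fun s t => l₂₁ s * r₁₁ t + l₂₂ s * r₂₁ t,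
    fun s t => l₁₁ s * r₁₁ t + l₁₂ s * r₂₁ t, fun s t => l₂₁ s * r₁₂ t + l₂₂ s * r₂₂ t,
    m₁, m₂, n₁, n₂, ((hfst c₁₁).mul (hsnd cr₁₂)).add ((hfst c₁₂).mul (hsnd cr₂₂)),
    ((hfst c₂₁).mul (hsnd cr₁₁)).add ((hfst c₂₂).mul (hsnd cr₂₁)), fun s hs t ht => ?_,
    fun s hs => ?_⟩
  · refine ⟨?_, ?_, ?_, ?_, ?_, ?_, ?_⟩
    · exact (((d₁ s hs).1.mul_const (r₁₂ t)).add ((d₂ s hs).1.mul_const (r₂₂ t))).congr_deriv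
        (by ring)
    · exact (((dr₁₂ t ht).const_mul (l₁₁ s)).add ((dr₂₂ t ht).const_mul (l₁₂ s))).congr_deriv
        (by ring)
    · exact (((d₁ s hs).2.mul_const (r₁₁ t)).add ((d₂ s hs).2.mul_const (r₂₁ t))).congr_deriv
        (by ring)
    · exact (((dr₁₁ t ht).const_mul (l₂₁ s)).add ((dr₂₁ t ht).const_mul (l₂₂ s))).congr_deriv
        (by ring)
    · exact (((dr₁₁ t ht).const_mul (l₁₁ s)).add ((dr₂₁ t ht).const_mul (l₁₂ s))).congr_deriv
        (by ring)
    · exact (((dr₁₂ t ht).const_mul (l₂₁ s)).add ((dr₂₂ t ht).const_mul (l₂₂ s))).congr_deriv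
        (by ring)
    · linear_combination (r₁₁ t * r₂₂ t - r₁₂ t * r₂₁ t) * hdet s hs + hdetR t ht
  · obtain ⟨e₁, e₂, e₃, e₄⟩ := hdiag s hs
    dsimp only
    rw [e₁, e₂, e₃, e₄]
    exact ⟨rfl, rfl, em₁ s hs, en₁ s hs, em₂ s hs, en₂ s hs⟩

theorem exists_wave_map_cauchy {I : Set ℝ} (hI : IsOpen I) (hI' : I.OrdConnected)
    {γ : ℝ → ℝ × ℝ} (hγ : ContDiffOn ℝ (⊤ : ℕ∞) γ I)
    (hx' : ∀ s ∈ I, deriv (fun r => (γ r).1) s ≠ 0)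
    (hy' : ∀ s ∈ I, deriv (fun r => (γ r).2) s ≠ 0)
    {φ₁ φ₂ ψ₁ ψ₂ : ℝ → ℝ}
    (hφ₁ : ContDiffOn ℝ (⊤ : ℕ∞) φ₁ I) (hφ₂ : ContDiffOn ℝ (⊤ : ℕ∞) φ₂ I)
    (hψ₁ : ContDiffOn ℝ (⊤ : ℕ∞) ψ₁ I) (hψ₂ : ContDiffOn ℝ (⊤ : ℕ∞) ψ₂ I) :
    ∃ (U : Set (ℝ × ℝ)) (u v : ℝ → ℝ → ℝ),
      IsOpen U ∧ γ '' I ⊆ U ∧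
      ContDiffOn ℝ (⊤ : ℕ∞) (fun p : ℝ × ℝ => u p.1 p.2) U ∧
      ContDiffOn ℝ (⊤ : ℕ∞) (fun p : ℝ × ℝ => v p.1 p.2) U ∧
      IsWaveMap U u v ∧
      (∀ s ∈ I,
        u (γ s).1 (γ s).2 = φ₁ s ∧ v (γ s).1 (γ s).2 = φ₂ s ∧
        normalDeriv u γ s = ψ₁ s ∧ normalDeriv v γ s = ψ₂ s) := by
  rcases I.eq_empty_or_nonempty with rfl | ⟨s₀, hs₀⟩
  · exact ⟨∅, fun _ _ => 0, fun _ _ => 0, isOpen_empty, by simp, by simp, by simp,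
      fun p hp => hp.elim, fun s hs => hs.elim⟩
  set X : ℝ → ℝ := fun r => (γ r).1 with hXdef
  set Y : ℝ → ℝ := fun r => (γ r).2 with hYdef
  have hX : ContDiffOn ℝ (⊤ : ℕ∞) X I := hγ.fst
  have hY : ContDiffOn ℝ (⊤ : ℕ∞) Y I := hγ.snd
  have hderiv : ∀ {f : ℝ → ℝ}, ContDiffOn ℝ (⊤ : ℕ∞) f I → ContDiffOn ℝ (⊤ : ℕ∞) (deriv f) I :=
    fun {f} hf => hf.deriv_of_isOpen hI (by simp)
  set N : ℝ → ℝ := fun s => Real.sqrt (deriv X s ^ 2 + deriv Y s ^ 2) with hNdef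
  have hNpos : ∀ s ∈ I, 0 < deriv X s ^ 2 + deriv Y s ^ 2 := fun s hs => by
    have := hx' s hs
    positivity
  have hN : ContDiffOn ℝ (⊤ : ℕ∞) N I :=
    (((hderiv hX).pow 2).add ((hderiv hY).pow 2)).sqrt fun s hs => (hNpos s hs).ne'
  have hN0 : ∀ s ∈ I, N s ≠ 0 := fun s hs => (Real.sqrt_pos.2 (hNpos s hs)).ne'
  have hNsq : ∀ s ∈ I, N s ^ 2 = deriv X s ^ 2 + deriv Y s ^ 2 := fun s hs =>
    Real.sq_sqrt (hNpos s hs).le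
  -- Along the curve, `fx φ ψ` and `fy φ ψ` are the partials prescribed by the Cauchy data.
  set fx : (ℝ → ℝ) → (ℝ → ℝ) → ℝ → ℝ := fun φ ψ s =>
    (deriv X s * deriv φ s - deriv Y s * N s * ψ s) / N s ^ 2 with hfx
  set fy : (ℝ → ℝ) → (ℝ → ℝ) → ℝ → ℝ := fun φ ψ s =>
    (deriv Y s * deriv φ s + deriv X s * N s * ψ s) / N s ^ 2 with hfy
  have hfxs : ∀ {φ ψ : ℝ → ℝ}, ContDiffOn ℝ (⊤ : ℕ∞) φ I → ContDiffOn ℝ (⊤ : ℕ∞) ψ I →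
      ContDiffOn ℝ (⊤ : ℕ∞) (fx φ ψ) I := fun {φ ψ} hφ hψ =>
    (((hderiv hX).mul (hderiv hφ)).sub (((hderiv hY).mul hN).mul hψ)).div (hN.pow 2)
      fun s hs => pow_ne_zero 2 (hN0 s hs)
  have hfys : ∀ {φ ψ : ℝ → ℝ}, ContDiffOn ℝ (⊤ : ℕ∞) φ I → ContDiffOn ℝ (⊤ : ℕ∞) ψ I →
      ContDiffOn ℝ (⊤ : ℕ∞) (fy φ ψ) I := fun {φ ψ} hφ hψ =>
    (((hderiv hY).mul (hderiv hφ)).add (((hderiv hX).mul hN).mul hψ)).div (hN.pow 2)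
      fun s hs => pow_ne_zero 2 (hN0 s hs)
  have hfφ : ∀ (φ ψ : ℝ → ℝ), ∀ s ∈ I, deriv X s * fx φ ψ s + deriv Y s * fy φ ψ s = deriv φ s :=
    fun φ ψ s hs => by
      have h := hN0 s hs
      simp only [hfx, hfy]
      field_simp
      linear_combination -deriv φ s * hNsq s hs
  have hfψ : ∀ (φ ψ : ℝ → ℝ), ∀ s ∈ I,
      (fx φ ψ s * -deriv Y s + fy φ ψ s * deriv X s) / N s = ψ s := fun φ ψ s hs => by
    have h := hN0 s hs
    simp only [hfx, hfy]
    field_simp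
    linear_combination (-ψ s * N s) * hNsq s hs
  set E : (ℝ → ℝ) → ℝ → ℝ := fun φ s => Real.exp (φ s / 2) with hE
  have hE0 : ∀ φ s, 0 < E φ s := fun φ s => Real.exp_pos _
  have hEs : ∀ {φ : ℝ → ℝ}, ContDiffOn ℝ (⊤ : ℕ∞) φ I → ContDiffOn ℝ (⊤ : ℕ∞) (E φ) I :=
    fun {φ} hφ => (hφ.div_const 2).exp
  have hE' : ∀ {φ : ℝ → ℝ} (ψ : ℝ → ℝ), ContDiffOn ℝ (⊤ : ℕ∞) φ I → ∀ s ∈ I,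
      HasDerivAt (E φ) (E φ s * (deriv X s * fx φ ψ s) / 2 +
        E φ s * (deriv Y s * fy φ ψ s) / 2) s := fun {φ} ψ hφ s hs => by
    have h1 : HasDerivAt φ (deriv φ s) s :=
      ((hφ.contDiffAt (hI.mem_nhds hs)).differentiableAt (by simp)).hasDerivAt
    refine (h1.div_const 2).exp.congr_deriv ?_
    rw [← hfφ φ ψ s hs]
    simp only [hE]
    ring
  have hs_data : ∀ {φ ψ : ℝ → ℝ}, ContDiffOn ℝ (⊤ : ℕ∞) φ I → ContDiffOn ℝ (⊤ : ℕ∞) ψ I →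
      ContDiffOn ℝ (⊤ : ℕ∞) (fun s => E φ s * (deriv X s * fx φ ψ s) / 2) I := fun {φ ψ} hφ hψ =>
    ((hEs hφ).mul ((hderiv hX).mul (hfxs hφ hψ))).div_const 2
  have ht_data : ∀ {φ ψ : ℝ → ℝ}, ContDiffOn ℝ (⊤ : ℕ∞) φ I → ContDiffOn ℝ (⊤ : ℕ∞) ψ I →
      ContDiffOn ℝ (⊤ : ℕ∞) (fun s => E φ s * (deriv Y s * fy φ ψ s) / 2) I := fun {φ ψ} hφ hψ =>
    ((hEs hφ).mul ((hderiv hY).mul (hfys hφ hψ))).div_const 2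
  obtain ⟨p, q, a, b, m₁, m₂, n₁, n₂, cp, cq, hsys, hdiag⟩ :=
    exists_factorized_matrix hI hI' hs₀ (hEs hφ₁) (hEs hφ₂) (hs_data hφ₁ hψ₁)
      (hs_data hφ₂ hψ₂) (ht_data hφ₂ hψ₂) (fun s _ => hE0 φ₁ s) (fun s _ => hE0 φ₂ s)
      (hE' ψ₁ hφ₁) (hE' ψ₂ hφ₂)
  obtain ⟨σ, hJ, hσs, hσ⟩ := exists_smooth_inverse hI hI' hX hx'
  obtain ⟨τ, hK, hτs, hτ⟩ := exists_smooth_inverse hI hI' hY hy'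
  have hmaps : MapsTo (fun z : ℝ × ℝ => (σ z.1, τ z.2)) ((X '' I) ×ˢ (Y '' I)) (I ×ˢ I) := by
    rintro ⟨_, _⟩ ⟨⟨s, hs, rfl⟩, ⟨t, ht, rfl⟩⟩
    exact ⟨by simpa only [(hσ s hs).1] using hs, by simpa only [(hτ t ht).1] using ht⟩
  have hστ : ContDiffOn ℝ (⊤ : ℕ∞) (fun z : ℝ × ℝ => (σ z.1, τ z.2)) ((X '' I) ×ˢ (Y '' I)) :=
    (hσs.comp contDiffOn_fst fun z hz => hz.1).prodMk (hτs.comp contDiffOn_snd fun z hz => hz.2)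
  have cp' : ContDiffOn ℝ (⊤ : ℕ∞) (fun z : ℝ × ℝ => p (σ z.1) (τ z.2)) ((X '' I) ×ˢ (Y '' I)) :=
    cp.comp hστ hmaps
  have cq' : ContDiffOn ℝ (⊤ : ℕ∞) (fun z : ℝ × ℝ => q (σ z.1) (τ z.2)) ((X '' I) ×ˢ (Y '' I)) :=
    cq.comp hστ hmaps
  set U : Set (ℝ × ℝ) := (X '' I) ×ˢ (Y '' I) ∩
    (fun z : ℝ × ℝ => (p (σ z.1) (τ z.2), q (σ z.1) (τ z.2))) ⁻¹' (Ioi 0 ×ˢ Ioi 0) with hUdef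
  have hU : IsOpen U := (cp'.continuousOn.prodMk cq'.continuousOn).isOpen_inter_preimage
    (hJ.prod hK) (isOpen_Ioi.prod isOpen_Ioi)
  have hUp : ∀ z ∈ U, 0 < p (σ z.1) (τ z.2) := fun z hz => hz.2.1
  have hUq : ∀ z ∈ U, 0 < q (σ z.1) (τ z.2) := fun z hz => hz.2.2
  have hγU : ∀ s ∈ I, (X s, Y s) ∈ U := fun s hs => by
    refine ⟨⟨mem_image_of_mem X hs, mem_image_of_mem Y hs⟩, ?_, ?_⟩
    · simp only [mem_Ioi, (hσ s hs).1, (hτ s hs).1, (hdiag s hs).1, hE0]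
    · simp only [mem_Ioi, (hσ s hs).1, (hτ s hs).1, (hdiag s hs).2.1, hE0]
  have hmem : ∀ z ∈ U, σ z.1 ∈ I ∧ τ z.2 ∈ I ∧ HasDerivAt σ (deriv X (σ z.1))⁻¹ z.1 ∧
      HasDerivAt τ (deriv Y (τ z.2))⁻¹ z.2 := by
    rintro ⟨_, _⟩ ⟨⟨⟨s, hs, rfl⟩, ⟨t, ht, rfl⟩⟩, -⟩
    dsimp only
    rw [(hσ s hs).1, (hτ t ht).1]
    exact ⟨hs, ht, (hσ s hs).2, (hτ t ht).2⟩
  have hsysU : ∀ z ∈ U, _ := fun z hz => hsys (σ z.1) (hmem z hz).1 (τ z.2) (hmem z hz).2.1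
  have hu := @two_log_wave_equation U hU (fun x y => p (σ x) (τ y)) (fun x y => q (σ x) (τ y))
    (fun x y => a (σ x) (τ y)) (fun x y => b (σ x) (τ y)) (fun x => (deriv X (σ x))⁻¹ * m₁ (σ x))
    (fun y => n₁ (τ y) * (deriv Y (τ y))⁻¹) hUp hUq
    (fun z hz => ((hsysU z hz).1.comp z.1 (hmem z hz).2.2.1).congr_deriv (by ring))
    (fun z hz => ((hsysU z hz).2.1.comp z.2 (hmem z hz).2.2.2).congr_deriv (by ring))
    (fun z hz => ((hsysU z hz).2.2.2.2.2.1.comp z.2 (hmem z hz).2.2.2).congr_deriv (by ring))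
    (fun z hz => (hsysU z hz).2.2.2.2.2.2)
  have hv := @two_log_wave_equation U hU (fun x y => q (σ x) (τ y)) (fun x y => p (σ x) (τ y))
    (fun x y => b (σ x) (τ y)) (fun x y => a (σ x) (τ y)) (fun x => (deriv X (σ x))⁻¹ * m₂ (σ x))
    (fun y => n₂ (τ y) * (deriv Y (τ y))⁻¹) hUq hUp
    (fun z hz => ((hsysU z hz).2.2.1.comp z.1 (hmem z hz).2.2.1).congr_deriv (by ring))
    (fun z hz => ((hsysU z hz).2.2.2.1.comp z.2 (hmem z hz).2.2.2).congr_deriv (by ring))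
    (fun z hz => ((hsysU z hz).2.2.2.2.1.comp z.2 (hmem z hz).2.2.2).congr_deriv (by ring))
    (fun z hz => by
      have h := (hsysU z hz).2.2.2.2.2.2
      linear_combination h)
  refine ⟨U, fun x y => 2 * Real.log (p (σ x) (τ y)), fun x y => 2 * Real.log (q (σ x) (τ y)),
    hU, ?_, ?_, ?_, fun z hz => ?_, fun s hs => ?_⟩
  · rintro _ ⟨s, hs, rfl⟩
    exact hγU s hs
  · exact contDiffOn_const.mul ((cp'.mono inter_subset_left).log fun z hz => (hUp z hz).ne')
  · exact contDiffOn_const.mul ((cq'.mono inter_subset_left).log fun z hz => (hUq z hz).ne')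
  · have hexp : Real.exp ((2 * Real.log (p (σ z.1) (τ z.2)) +
        2 * Real.log (q (σ z.1) (τ z.2))) / 2) = p (σ z.1) (τ z.2) * q (σ z.1) (τ z.2) := by
      rw [← mul_add, mul_div_cancel_left₀ _ two_ne_zero, Real.exp_add, Real.exp_log (hUp z hz),
        Real.exp_log (hUq z hz)]
    have h1 := (hu hz).2.2
    have h2 := (hv hz).2.2
    rw [mul_comm (q _ _)] at h2
    dsimp only
    rw [hexp]
    exact ⟨h1, h2⟩
  · have eσ : σ (X s) = s := (hσ s hs).1
    have eτ : τ (Y s) = s := (hτ s hs).1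
    obtain ⟨e₁, e₂, e₃, e₄, e₅, e₆⟩ := hdiag s hs
    have hxs : deriv X s ≠ 0 := hx' s hs
    have hys : deriv Y s ≠ 0 := hy' s hs
    have hE₁ := (hE0 φ₁ s).ne'
    have hE₂ := (hE0 φ₂ s).ne'
    obtain ⟨hux, huy, -⟩ := hu (hγU s hs)
    obtain ⟨hvx, hvy, -⟩ := hv (hγU s hs)
    simp only [eσ, eτ, e₁, e₂] at hux huy hvx hvy
    have hux' : 2 * ((deriv X s)⁻¹ * m₁ s * b s s / E φ₁ s) = fx φ₁ ψ₁ s := by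
      rw [mul_assoc, e₃]; field_simp
    have huy' : 2 * (a s s * (n₁ s * (deriv Y s)⁻¹) / E φ₁ s) = fy φ₁ ψ₁ s := by
      rw [← mul_assoc, e₄]; field_simp
    have hvx' : 2 * ((deriv X s)⁻¹ * m₂ s * a s s / E φ₂ s) = fx φ₂ ψ₂ s := by
      rw [mul_assoc, e₅]; field_simp
    have hvy' : 2 * (b s s * (n₂ s * (deriv Y s)⁻¹) / E φ₂ s) = fy φ₂ ψ₂ s := by
      rw [← mul_assoc, e₆]; field_simp
    rw [hux'] at hux
    rw [huy'] at huy
    rw [hvx'] at hvx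
    rw [hvy'] at hvy
    refine ⟨?_, ?_, ?_, ?_⟩
    · change 2 * Real.log (p (σ (X s)) (τ (Y s))) = φ₁ s
      rw [eσ, eτ, e₁, Real.log_exp]; ring
    · change 2 * Real.log (q (σ (X s)) (τ (Y s))) = φ₂ s
      rw [eσ, eτ, e₂, Real.log_exp]; ring
    · rw [← hfψ φ₁ ψ₁ s hs, ← hux, ← huy]; rfl
    · rw [← hfψ φ₂ ψ₂ s hs, ← hvx, ← hvy]; rfl

end

/-- local existence and local uniqueness for the Cauchy problem for the
wave map system (WM), with data posed along a smooth injective noncharacteristic curve. -/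
theorem cauchy_problem_wave_map
    (I : Set ℝ) (hIopen : IsOpen I) (hIinterval : I.OrdConnected)
    (γ : ℝ → ℝ × ℝ) (hγ : ContDiffOn ℝ (⊤ : ℕ∞) γ I) (hγinj : Set.InjOn γ I)
    (hx' : ∀ s ∈ I, deriv (fun r => (γ r).1) s ≠ 0)
    (hy' : ∀ s ∈ I, deriv (fun r => (γ r).2) s ≠ 0)
    (φ₁ φ₂ ψ₁ ψ₂ : ℝ → ℝ)
    (hφ₁ : ContDiffOn ℝ (⊤ : ℕ∞) φ₁ I) (hφ₂ : ContDiffOn ℝ (⊤ : ℕ∞) φ₂ I)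
    (hψ₁ : ContDiffOn ℝ (⊤ : ℕ∞) ψ₁ I) (hψ₂ : ContDiffOn ℝ (⊤ : ℕ∞) ψ₂ I) :
    (∃ (U : Set (ℝ × ℝ)) (u v : ℝ → ℝ → ℝ),
        IsOpen U ∧ γ '' I ⊆ U ∧
        ContDiffOn ℝ (⊤ : ℕ∞) (fun p : ℝ × ℝ => u p.1 p.2) U ∧
        ContDiffOn ℝ (⊤ : ℕ∞) (fun p : ℝ × ℝ => v p.1 p.2) U ∧
        IsWaveMap U u v ∧
        (∀ s ∈ I,
          u (γ s).1 (γ s).2 = φ₁ s ∧ v (γ s).1 (γ s).2 = φ₂ s ∧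
          normalDeriv u γ s = ψ₁ s ∧ normalDeriv v γ s = ψ₂ s)) ∧
    (∀ (U₁ U₂ : Set (ℝ × ℝ)) (u₁ v₁ u₂ v₂ : ℝ → ℝ → ℝ),
        IsOpen U₁ → γ '' I ⊆ U₁ → IsOpen U₂ → γ '' I ⊆ U₂ →
        ContDiffOn ℝ 2 (fun p : ℝ × ℝ => u₁ p.1 p.2) U₁ →
        ContDiffOn ℝ 2 (fun p : ℝ × ℝ => v₁ p.1 p.2) U₁ →
        ContDiffOn ℝ 2 (fun p : ℝ × ℝ => u₂ p.1 p.2) U₂ →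
        ContDiffOn ℝ 2 (fun p : ℝ × ℝ => v₂ p.1 p.2) U₂ →
        IsWaveMap U₁ u₁ v₁ → IsWaveMap U₂ u₂ v₂ →
        (∀ s ∈ I,
          u₁ (γ s).1 (γ s).2 = φ₁ s ∧ v₁ (γ s).1 (γ s).2 = φ₂ s ∧
          normalDeriv u₁ γ s = ψ₁ s ∧ normalDeriv v₁ γ s = ψ₂ s) →
        (∀ s ∈ I,
          u₂ (γ s).1 (γ s).2 = φ₁ s ∧ v₂ (γ s).1 (γ s).2 = φ₂ s ∧
          normalDeriv u₂ γ s = ψ₁ s ∧ normalDeriv v₂ γ s = ψ₂ s) →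
        ∃ W : Set (ℝ × ℝ), IsOpen W ∧ γ '' I ⊆ W ∧ W ⊆ U₁ ∩ U₂ ∧
          ∀ p ∈ W, u₁ p.1 p.2 = u₂ p.1 p.2 ∧ v₁ p.1 p.2 = v₂ p.1 p.2) := by
  refine ⟨exists_wave_map_cauchy hIopen hIinterval hγ hx' hy' hφ₁ hφ₂ hψ₁ hψ₂, ?_⟩
  intro U₁ U₂ u₁ v₁ u₂ v₂ hU₁ hγU₁ hU₂ hγU₂ hu₁ hv₁ hu₂ hv₂ h₁ h₂ hd₁ hd₂
  have hjet : ∀ s ∈ I, jet u₁ v₁ (γ s) = jet u₂ v₂ (γ s) := fun s hs => by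
    have hγs : DifferentiableAt ℝ γ s :=
      (hγ.contDiffAt (hIopen.mem_nhds hs)).differentiableAt (by simp)
    have m₁ : γ s ∈ U₁ := hγU₁ (Set.mem_image_of_mem γ hs)
    have m₂ : γ s ∈ U₂ := hγU₂ (Set.mem_image_of_mem γ hs)
    obtain ⟨hux, huy⟩ := partials_eq_of_cauchy_data_eq hU₁ hU₂ hu₁ hu₂ hIopen hs m₁ m₂ hγs
      (hx' s hs) (fun r hr => (hd₁ r hr).1) (fun r hr => (hd₂ r hr).1)
      ((hd₁ s hs).2.2.1.trans (hd₂ s hs).2.2.1.symm)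
    obtain ⟨hvx, hvy⟩ := partials_eq_of_cauchy_data_eq hU₁ hU₂ hv₁ hv₂ hIopen hs m₁ m₂ hγs
      (hx' s hs) (fun r hr => (hd₁ r hr).2.1) (fun r hr => (hd₂ r hr).2.1)
      ((hd₁ s hs).2.2.2.trans (hd₂ s hs).2.2.2.symm)
    simp only [jet, hux, huy, hvx, hvy, (hd₁ s hs).1, (hd₂ s hs).1, (hd₁ s hs).2.1,
      (hd₂ s hs).2.1]
  have hloc : ∀ s : I, ∃ W : Set (ℝ × ℝ), IsOpen W ∧ γ s ∈ W ∧ W ⊆ U₁ ∩ U₂ ∧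
      ∀ p ∈ W, u₁ p.1 p.2 = u₂ p.1 p.2 ∧ v₁ p.1 p.2 = v₂ p.1 p.2 := fun s =>
    IsWaveMap.eq_near_of_jet_eq hIopen hγ hx' hy' (hU₁.inter hU₂)
      (hu₁.mono Set.inter_subset_left) (hv₁.mono Set.inter_subset_left)
      (hu₂.mono Set.inter_subset_right) (hv₂.mono Set.inter_subset_right)
      (fun p hp => h₁ p hp.1) (fun p hp => h₂ p hp.2) hjet s.2
      ⟨hγU₁ (Set.mem_image_of_mem γ s.2), hγU₂ (Set.mem_image_of_mem γ s.2)⟩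
  choose W hWo hWm hWs hWe using hloc
  refine ⟨⋃ s, W s, isOpen_iUnion hWo, ?_, Set.iUnion_subset hWs, fun p hp => ?_⟩
  · rintro _ ⟨s, hs, rfl⟩
    exact Set.mem_iUnion.2 ⟨⟨s, hs⟩, hWm ⟨s, hs⟩⟩
  · obtain ⟨s, hs⟩ := Set.mem_iUnion.1 hp
    exact hWe s p hs
end

section
/- Let U ⊆ ℝ² be open and u₁, u₂ : U → ℝ be C². Set u = u₁ + u₂ and v = u₁ − u₂. Then (u₁, u₂) satisfies the Euler–Lagrange system of the energy functional for maps from (ℝ^{1,1}, dx dy) into the metric (du₁² − du₂²)/(1 + e^{−u₁}), namely ∂²u₁/∂x∂y + ((u₁)_x (u₁)_y + (u₂)_x (u₂)_y)/(2(1 + exp(u₁))) = 0 and ∂²u₂/∂x∂y + ((u₁)_x (u₂)_y + (u₂)_x (u₁)_y)/(2(1 + exp(u₁))) = 0 on U, if and only if (u, v) satisfies the wave map system (WM) on U. -/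
section PartialDerivatives

variable {U : Set (ℝ × ℝ)} {f g : ℝ → ℝ → ℝ} {p : ℝ × ℝ}

theorem hasDerivAt_fst_of_differentiableAt
    (hf : DifferentiableAt ℝ (fun q : ℝ × ℝ => f q.1 q.2) p) :
    HasDerivAt (fun x => f x p.2) (fderiv ℝ (fun q : ℝ × ℝ => f q.1 q.2) p (1, 0)) p.1 :=
  HasFDerivAt.comp_hasDerivAt (f := fun x : ℝ => (x, p.2)) p.1 hf.hasFDerivAt
    ((hasDerivAt_id p.1).prodMk (hasDerivAt_const p.1 p.2))

theorem hasDerivAt_snd_of_differentiableAt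
    (hf : DifferentiableAt ℝ (fun q : ℝ × ℝ => f q.1 q.2) p) :
    HasDerivAt (fun y => f p.1 y) (fderiv ℝ (fun q : ℝ × ℝ => f q.1 q.2) p (0, 1)) p.2 :=
  HasFDerivAt.comp_hasDerivAt (f := fun y : ℝ => (p.1, y)) p.2 hf.hasFDerivAt
    ((hasDerivAt_const p.2 p.1).prodMk (hasDerivAt_id p.2))

theorem ContDiffOn.differentiableAt_of_isOpen (hU : IsOpen U)
    (hf : ContDiffOn ℝ 2 (fun q : ℝ × ℝ => f q.1 q.2) U) (hp : p ∈ U) :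
    DifferentiableAt ℝ (fun q : ℝ × ℝ => f q.1 q.2) p :=
  (hf.differentiableOn (by norm_num)).differentiableAt (hU.mem_nhds hp)

theorem differentiableAt_px_snd (hU : IsOpen U)
    (hf : ContDiffOn ℝ 2 (fun q : ℝ × ℝ => f q.1 q.2) U) (hp : p ∈ U) :
    DifferentiableAt ℝ (fun y => px f p.1 y) p.2 := by
  have hfd : DifferentiableAt ℝ (fderiv ℝ (fun q : ℝ × ℝ => f q.1 q.2)) p :=
    ((hf.fderiv_of_isOpen hU (m := 1) (by norm_num)).differentiableOn
      (by norm_num)).differentiableAt (hU.mem_nhds hp)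
  have hpx : (fun q : ℝ × ℝ => px f q.1 q.2) =ᶠ[nhds p]
      fun q => fderiv ℝ (fun q : ℝ × ℝ => f q.1 q.2) q (1, 0) := by
    filter_upwards [hU.mem_nhds hp] with q hq
    exact (hasDerivAt_fst_of_differentiableAt (hf.differentiableAt_of_isOpen hU hq)).deriv
  have hd : DifferentiableAt ℝ (fun q : ℝ × ℝ => px f q.1 q.2) p :=
    (hfd.clm_apply (differentiableAt_const _)).congr_of_eventuallyEq hpx
  exact (hasDerivAt_snd_of_differentiableAt hd).differentiableAt

theorem px_add (hf : DifferentiableAt ℝ (fun q : ℝ × ℝ => f q.1 q.2) p)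
    (hg : DifferentiableAt ℝ (fun q : ℝ × ℝ => g q.1 q.2) p) :
    px (fun x y => f x y + g x y) p.1 p.2 = px f p.1 p.2 + px g p.1 p.2 :=
  deriv_fun_add (hasDerivAt_fst_of_differentiableAt hf).differentiableAt
    (hasDerivAt_fst_of_differentiableAt hg).differentiableAt

theorem px_sub (hf : DifferentiableAt ℝ (fun q : ℝ × ℝ => f q.1 q.2) p)
    (hg : DifferentiableAt ℝ (fun q : ℝ × ℝ => g q.1 q.2) p) :
    px (fun x y => f x y - g x y) p.1 p.2 = px f p.1 p.2 - px g p.1 p.2 :=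
  deriv_fun_sub (hasDerivAt_fst_of_differentiableAt hf).differentiableAt
    (hasDerivAt_fst_of_differentiableAt hg).differentiableAt

theorem py_add (hf : DifferentiableAt ℝ (fun q : ℝ × ℝ => f q.1 q.2) p)
    (hg : DifferentiableAt ℝ (fun q : ℝ × ℝ => g q.1 q.2) p) :
    py (fun x y => f x y + g x y) p.1 p.2 = py f p.1 p.2 + py g p.1 p.2 :=
  deriv_fun_add (hasDerivAt_snd_of_differentiableAt hf).differentiableAt
    (hasDerivAt_snd_of_differentiableAt hg).differentiableAt

theorem py_sub (hf : DifferentiableAt ℝ (fun q : ℝ × ℝ => f q.1 q.2) p)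
    (hg : DifferentiableAt ℝ (fun q : ℝ × ℝ => g q.1 q.2) p) :
    py (fun x y => f x y - g x y) p.1 p.2 = py f p.1 p.2 - py g p.1 p.2 :=
  deriv_fun_sub (hasDerivAt_snd_of_differentiableAt hf).differentiableAt
    (hasDerivAt_snd_of_differentiableAt hg).differentiableAt

theorem eventually_mk_mem_of_isOpen (hU : IsOpen U) (hp : p ∈ U) :
    ∀ᶠ y in nhds p.2, (p.1, y) ∈ U :=
  (Continuous.prodMk_right p.1).continuousAt.eventually_mem (hU.mem_nhds hp)

theorem pxy_add (hU : IsOpen U) (hf : ContDiffOn ℝ 2 (fun q : ℝ × ℝ => f q.1 q.2) U)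
    (hg : ContDiffOn ℝ 2 (fun q : ℝ × ℝ => g q.1 q.2) U) (hp : p ∈ U) :
    pxy (fun x y => f x y + g x y) p.1 p.2 = pxy f p.1 p.2 + pxy g p.1 p.2 := by
  have h : (fun y => px (fun x y => f x y + g x y) p.1 y) =ᶠ[nhds p.2]
      fun y => px f p.1 y + px g p.1 y := by
    filter_upwards [eventually_mk_mem_of_isOpen hU hp] with y hy
    exact px_add (hf.differentiableAt_of_isOpen hU hy) (hg.differentiableAt_of_isOpen hU hy)
  exact h.deriv_eq.trans
    (deriv_fun_add (differentiableAt_px_snd hU hf hp) (differentiableAt_px_snd hU hg hp))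

theorem pxy_sub (hU : IsOpen U) (hf : ContDiffOn ℝ 2 (fun q : ℝ × ℝ => f q.1 q.2) U)
    (hg : ContDiffOn ℝ 2 (fun q : ℝ × ℝ => g q.1 q.2) U) (hp : p ∈ U) :
    pxy (fun x y => f x y - g x y) p.1 p.2 = pxy f p.1 p.2 - pxy g p.1 p.2 := by
  have h : (fun y => px (fun x y => f x y - g x y) p.1 y) =ᶠ[nhds p.2]
      fun y => px f p.1 y - px g p.1 y := by
    filter_upwards [eventually_mk_mem_of_isOpen hU hp] with y hy
    exact px_sub (hf.differentiableAt_of_isOpen hU hy) (hg.differentiableAt_of_isOpen hU hy)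
  exact h.deriv_eq.trans
    (deriv_fun_sub (differentiableAt_px_snd hU hf hp) (differentiableAt_px_snd hU hg hp))

end PartialDerivatives

/-- `(u₁, u₂)` solves the Euler–Lagrange system for the energy of maps
into `(du₁² - du₂²)/(1 + e^{-u₁})` iff `(u, v) = (u₁ + u₂, u₁ - u₂)` solves (WM). -/
theorem euler_lagrange_iff_wave_map
    (U : Set (ℝ × ℝ)) (hU : IsOpen U) (u₁ u₂ : ℝ → ℝ → ℝ)
    (hu₁ : ContDiffOn ℝ 2 (fun p : ℝ × ℝ => u₁ p.1 p.2) U)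
    (hu₂ : ContDiffOn ℝ 2 (fun p : ℝ × ℝ => u₂ p.1 p.2) U) :
    (∀ p ∈ U,
      pxy u₁ p.1 p.2 +
          (px u₁ p.1 p.2 * py u₁ p.1 p.2 + px u₂ p.1 p.2 * py u₂ p.1 p.2) /
            (2 * (1 + Real.exp (u₁ p.1 p.2))) = 0 ∧
      pxy u₂ p.1 p.2 +
          (px u₁ p.1 p.2 * py u₂ p.1 p.2 + px u₂ p.1 p.2 * py u₁ p.1 p.2) /
            (2 * (1 + Real.exp (u₁ p.1 p.2))) = 0) ↔
    IsWaveMap U (fun x y => u₁ x y + u₂ x y) (fun x y => u₁ x y - u₂ x y) := by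
  refine forall₂_congr fun p hp => ?_
  have h₁ := hu₁.differentiableAt_of_isOpen hU hp
  have h₂ := hu₂.differentiableAt_of_isOpen hU hp
  have hexp : (u₁ p.1 p.2 + u₂ p.1 p.2 + (u₁ p.1 p.2 - u₂ p.1 p.2)) / 2 = u₁ p.1 p.2 := by ring
  rw [pxy_add hU hu₁ hu₂ hp, pxy_sub hU hu₁ hu₂ hp, px_add h₁ h₂, px_sub h₁ h₂,
    py_add h₁ h₂, py_sub h₁ h₂, hexp]
  constructor
  · rintro ⟨ha, hb⟩
    exact ⟨by linear_combination ha + hb, by linear_combination ha - hb⟩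
  · rintro ⟨ha, hb⟩
    exact ⟨by linear_combination (ha + hb) / 2, by linear_combination (ha - hb) / 2⟩
end

section
/- Let U ⊆ ℝ² be open and let u, v : U → ℝ be C² solutions of the wave map system (WM). Then the first-order differential function α₁ = u_x v_x/(1 + exp(−(u+v)/2)) is a first integral of the characteristic system transverse to y: at every point of U, ∂/∂y [ u_x(x,y) v_x(x,y) / (1 + exp(−(u(x,y)+v(x,y))/2)) ] = 0. -/
/-- A function that is differentiable at a point has its second partial derivative there. -/
theorem hasDerivAt_py {u : ℝ → ℝ → ℝ} {p : ℝ × ℝ}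
    (hu : DifferentiableAt ℝ (fun q : ℝ × ℝ => u q.1 q.2) p) :
    HasDerivAt (fun y => u p.1 y) (py u p.1 p.2) p.2 := by
  have h : DifferentiableAt ℝ (fun y => u p.1 y) p.2 :=
    DifferentiableAt.comp (g := fun q : ℝ × ℝ => u q.1 q.2) (f := fun y => (p.1, y)) p.2 hu
      (by fun_prop)
  exact h.hasDerivAt

/-- The first partial derivative is the total derivative in the direction `(1, 0)`. -/
theorem px_eq_fderiv {u : ℝ → ℝ → ℝ} {p : ℝ × ℝ}
    (hu : DifferentiableAt ℝ (fun q : ℝ × ℝ => u q.1 q.2) p) :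
    px u p.1 p.2 = fderiv ℝ (fun q : ℝ × ℝ => u q.1 q.2) p (1, 0) := by
  have hline : HasDerivAt (fun x => (x, p.2)) ((1 : ℝ), (0 : ℝ)) p.1 :=
    (hasDerivAt_id p.1).prodMk (hasDerivAt_const p.1 p.2)
  exact (HasFDerivAt.comp_hasDerivAt (l := fun q : ℝ × ℝ => u q.1 q.2) p.1
    hu.hasFDerivAt hline).deriv

/-- For a `C²` function, the first partial derivative is differentiable in the second variable. -/
theorem hasDerivAt_pxy {u : ℝ → ℝ → ℝ} {p : ℝ × ℝ}
    (hu : ContDiffAt ℝ 2 (fun q : ℝ × ℝ => u q.1 q.2) p) :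
    HasDerivAt (fun y => px u p.1 y) (pxy u p.1 p.2) p.2 := by
  have hpx : (fun q : ℝ × ℝ => px u q.1 q.2) =ᶠ[nhds p]
      fun q => fderiv ℝ (fun q : ℝ × ℝ => u q.1 q.2) q (1, 0) := by
    filter_upwards [hu.eventually (by simp)] with q hq
    exact px_eq_fderiv (hq.differentiableAt (by norm_num))
  have hfderiv : DifferentiableAt ℝ (fderiv ℝ (fun q : ℝ × ℝ => u q.1 q.2)) p :=
    (hu.fderiv_right (m := 1) (by norm_num)).differentiableAt (by norm_num)
  have hdiff : DifferentiableAt ℝ (fun q : ℝ × ℝ => px u q.1 q.2) p :=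
    (hfderiv.clm_apply (differentiableAt_const _)).congr_of_eventuallyEq hpx
  exact hasDerivAt_py hdiff

/-- for any C² solution of (WM), the first-order function
`α₁ = u_x v_x / (1 + exp(-(u+v)/2))` is a first integral of the characteristic
system transverse to `y`: its partial `y`-derivative vanishes on `U`. -/
theorem first_integral_alpha_one
    (U : Set (ℝ × ℝ)) (hU : IsOpen U) (u v : ℝ → ℝ → ℝ)
    (hu : ContDiffOn ℝ 2 (fun p : ℝ × ℝ => u p.1 p.2) U)
    (hv : ContDiffOn ℝ 2 (fun p : ℝ × ℝ => v p.1 p.2) U)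
    (hwm : IsWaveMap U u v) :
    ∀ p ∈ U,
      deriv (fun y' => px u p.1 y' * px v p.1 y' /
        (1 + Real.exp (-(u p.1 y' + v p.1 y') / 2))) p.2 = 0 := by
  intro p hp
  have hup := hu.contDiffAt (hU.mem_nhds hp)
  have hvp := hv.contDiffAt (hU.mem_nhds hp)
  have huy := hasDerivAt_py (hup.differentiableAt (by norm_num))
  have hvy := hasDerivAt_py (hvp.differentiableAt (by norm_num))
  have hden := (((huy.add hvy).neg.div_const 2).exp).const_add 1
  have hE := Real.exp_pos ((u p.1 p.2 + v p.1 p.2) / 2)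
  have hexp : Real.exp (-(u p.1 p.2 + v p.1 p.2) / 2) =
      (Real.exp ((u p.1 p.2 + v p.1 p.2) / 2))⁻¹ := by
    rw [neg_div, Real.exp_neg]
  have hquot := ((hasDerivAt_pxy hup).mul (hasDerivAt_pxy hvp)).div hden
    (by simp only [Pi.neg_apply, Pi.add_apply]; positivity)
  refine HasDerivAt.deriv (hquot.congr_deriv ?_)
  obtain ⟨h₁, h₂⟩ := hwm p hp
  simp only [Pi.neg_apply, Pi.add_apply, Pi.mul_apply]
  rw [hexp, eq_neg_of_add_eq_zero_left h₁, eq_neg_of_add_eq_zero_left h₂]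
  field_simp
  ring
end

section
/- Let U ⊆ ℝ² be open and let u, v : U → ℝ be C² solutions of the wave map system (WM). Then the first-order differential function β₁ = u_y v_y/(1 + exp(−(u+v)/2)) is a first integral of the characteristic system transverse to x: at every point of U, ∂/∂x [ u_y(x,y) v_y(x,y) / (1 + exp(−(u(x,y)+v(x,y))/2)) ] = 0. -/
lemma hasDerivAt_fst_slice {f : ℝ → ℝ → ℝ} {x y : ℝ}
    (hf : DifferentiableAt ℝ (fun p : ℝ × ℝ => f p.1 p.2) (x, y)) :
    HasDerivAt (fun x' => f x' y) (fderiv ℝ (fun p : ℝ × ℝ => f p.1 p.2) (x, y) (1, 0)) x :=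
  hf.hasFDerivAt.comp_hasDerivAt (f := fun x' : ℝ => (x', y)) x
    ((hasDerivAt_id x).prodMk (hasDerivAt_const x y))

lemma hasDerivAt_snd_slice {f : ℝ → ℝ → ℝ} {x y : ℝ}
    (hf : DifferentiableAt ℝ (fun p : ℝ × ℝ => f p.1 p.2) (x, y)) :
    HasDerivAt (fun y' => f x y') (fderiv ℝ (fun p : ℝ × ℝ => f p.1 p.2) (x, y) (0, 1)) y :=
  hf.hasFDerivAt.comp_hasDerivAt (f := fun y' : ℝ => (x, y')) y
    ((hasDerivAt_const y x).prodMk (hasDerivAt_id y))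

lemma hasDerivAt_px {f : ℝ → ℝ → ℝ} {x y : ℝ}
    (hf : DifferentiableAt ℝ (fun p : ℝ × ℝ => f p.1 p.2) (x, y)) :
    HasDerivAt (fun x' => f x' y) (px f x y) x :=
  (hasDerivAt_fst_slice hf).differentiableAt.hasDerivAt

/-- Equality of mixed partial derivatives: the `x`-derivative of `f_y` is `f_{xy}`. -/
lemma hasDerivAt_py_fst {f : ℝ → ℝ → ℝ} {x y : ℝ}
    (hf : ContDiffAt ℝ 2 (fun p : ℝ × ℝ => f p.1 p.2) (x, y)) :
    HasDerivAt (fun x' => py f x' y) (pxy f x y) x := by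
  set F : ℝ × ℝ → ℝ := fun p => f p.1 p.2
  have hdiff : ∀ᶠ p in nhds (x, y), DifferentiableAt ℝ F p :=
    (hf.eventually (by simp)).mono fun p hp => hp.differentiableAt (by simp)
  have hD : DifferentiableAt ℝ (fderiv ℝ F) (x, y) :=
    (hf.fderiv_right (m := 1) (by norm_num)).differentiableAt (by simp)
  have hcx : Filter.Tendsto (fun x' : ℝ => (x', y)) (nhds x) (nhds (x, y)) :=
    (Continuous.prodMk_left y).tendsto x
  have hcy : Filter.Tendsto (fun y' : ℝ => (x, y')) (nhds y) (nhds (x, y)) :=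
    (Continuous.prodMk_right x).tendsto y
  have hpy : (fun x' => py f x' y) =ᶠ[nhds x] fun x' => fderiv ℝ F (x', y) (0, 1) :=
    (hcx.eventually hdiff).mono fun x' h => (hasDerivAt_snd_slice h).deriv
  have hpx : (fun y' => px f x y') =ᶠ[nhds y] fun y' => fderiv ℝ F (x, y') (1, 0) :=
    (hcy.eventually hdiff).mono fun y' h => (hasDerivAt_fst_slice h).deriv
  have hx : HasDerivAt (fun x' => py f x' y)
      (fderiv ℝ (fderiv ℝ F) (x, y) (1, 0) (0, 1)) x := by
    have h := (hD.hasFDerivAt.comp_hasDerivAt (f := fun x' : ℝ => (x', y)) x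
      ((hasDerivAt_id x).prodMk (hasDerivAt_const x y))).clm_apply
        (hasDerivAt_const x ((0, 1) : ℝ × ℝ))
    simp only [map_zero, add_zero] at h
    exact h.congr_of_eventuallyEq hpy
  have hy : HasDerivAt (fun y' => px f x y')
      (fderiv ℝ (fderiv ℝ F) (x, y) (0, 1) (1, 0)) y := by
    have h := (hD.hasFDerivAt.comp_hasDerivAt (f := fun y' : ℝ => (x, y')) y
      ((hasDerivAt_const y x).prodMk (hasDerivAt_id y))).clm_apply
        (hasDerivAt_const y ((1, 0) : ℝ × ℝ))
    simp only [map_zero, add_zero] at h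
    exact h.congr_of_eventuallyEq hpx
  have hsymm : IsSymmSndFDerivAt ℝ F (x, y) := hf.isSymmSndFDerivAt (by simp)
  rw [pxy, hy.deriv, hsymm.eq]
  exact hx

/-- for any C² solution of (WM), the first-order function
`β₁ = u_y v_y / (1 + exp(-(u+v)/2))` is a first integral of the characteristic
system transverse to `x`: its partial `x`-derivative vanishes on `U`. -/
theorem first_integral_beta_one
    (U : Set (ℝ × ℝ)) (hU : IsOpen U) (u v : ℝ → ℝ → ℝ)
    (hu : ContDiffOn ℝ 2 (fun p : ℝ × ℝ => u p.1 p.2) U)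
    (hv : ContDiffOn ℝ 2 (fun p : ℝ × ℝ => v p.1 p.2) U)
    (hwm : IsWaveMap U u v) :
    ∀ p ∈ U,
      deriv (fun x' => py u x' p.2 * py v x' p.2 /
        (1 + Real.exp (-(u x' p.2 + v x' p.2) / 2))) p.1 = 0 := by
  rintro ⟨x, y⟩ hp
  have hu' := hu.contDiffAt (hU.mem_nhds hp)
  have hv' := hv.contDiffAt (hU.mem_nhds hp)
  obtain ⟨h1, h2⟩ := hwm _ hp
  dsimp only at h1 h2 ⊢
  have hux := hasDerivAt_px (hu'.differentiableAt (by simp))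
  have hvx := hasDerivAt_px (hv'.differentiableAt (by simp))
  have hE : 0 < Real.exp ((u x y + v x y) / 2) := Real.exp_pos _
  have hneg : Real.exp (-(u x y + v x y) / 2) = (Real.exp ((u x y + v x y) / 2))⁻¹ := by
    rw [← Real.exp_neg, neg_div]
  have hden : 1 + Real.exp (-(u x y + v x y) / 2) ≠ 0 := by positivity
  have hβ := ((hasDerivAt_py_fst hu').mul (hasDerivAt_py_fst hv')).div
    (((hux.add hvx).neg.div_const 2).exp.const_add 1) hden
  refine hβ.deriv.trans ?_
  simp only [Pi.mul_apply, Pi.add_apply, Pi.neg_apply]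
  rw [eq_neg_of_add_eq_zero_left h1, eq_neg_of_add_eq_zero_left h2, hneg]
  generalize Real.exp ((u x y + v x y) / 2) = E at hE
  have : 1 + E ≠ 0 := by positivity
  have : 1 + E⁻¹ ≠ 0 := by positivity
  field_simp
  ring
end

section
/- Let a = √2/4 and let U = {(x,y) ∈ ℝ² : cosh(a(x−y)) + √2 sinh(a(x−y)) > 0}, an open set containing the diagonal y = x. Define u(x,y) = v(x,y) = ln( (cosh(a(x−y)) + √2 sinh(a(x−y)))² ) on U. Then (u, v) is a solution of the wave map system (WM) on U and satisfies the Cauchy data along the diagonal: u(x,x) = v(x,x) = 0, u_x(x,x) = v_x(x,x) = 1 and u_y(x,x) = v_y(x,x) = −1 for all x ∈ ℝ (equivalently, the derivative of u and of v in the unit normal direction n = (1,−1)/√2 along y = x equals √2). -/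
/-- The constant `a = √2/4`. -/
noncomputable def aConst : ℝ := Real.sqrt 2 / 4

/-- The explicit solution `u(x,y) = v(x,y) = ln((cosh(a(x-y)) + √2 sinh(a(x-y)))²)`. -/
noncomputable def wSol (x y : ℝ) : ℝ :=
  Real.log ((Real.cosh (aConst * (x - y)) + Real.sqrt 2 * Real.sinh (aConst * (x - y))) ^ 2)

/-- The open set `U = {(x,y) : cosh(a(x-y)) + √2 sinh(a(x-y)) > 0}`. -/
def USol : Set (ℝ × ℝ) :=
  {p : ℝ × ℝ |
    0 < Real.cosh (aConst * (p.1 - p.2)) + Real.sqrt 2 * Real.sinh (aConst * (p.1 - p.2))}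

open Real in
lemma hasDerivAt_cosh_add_const_mul_sinh (a c t : ℝ) :
    HasDerivAt (fun t => cosh (a * t) + c * sinh (a * t))
      (a * (sinh (a * t) + c * cosh (a * t))) t := by
  have h : HasDerivAt (fun t : ℝ => a * t) a t := by
    simpa using (hasDerivAt_id t).const_mul a
  refine (h.cosh.add (h.sinh.const_mul c)).congr_deriv ?_
  ring

open Real in
lemma hasDerivAt_sinh_add_const_mul_cosh (a c t : ℝ) :
    HasDerivAt (fun t => sinh (a * t) + c * cosh (a * t))
      (a * (cosh (a * t) + c * sinh (a * t))) t := by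
  have h : HasDerivAt (fun t : ℝ => a * t) a t := by
    simpa using (hasDerivAt_id t).const_mul a
  refine (h.sinh.add (h.cosh.const_mul c)).congr_deriv ?_
  ring

/-- The derivative of the profile `t ↦ log ((cosh (a t) + √2 sinh (a t)) ^ 2)` of `wSol`. -/
noncomputable def wSlope (t : ℝ) : ℝ :=
  2 * aConst * ((Real.sinh (aConst * t) + Real.sqrt 2 * Real.cosh (aConst * t)) /
    (Real.cosh (aConst * t) + Real.sqrt 2 * Real.sinh (aConst * t)))

open Real in
lemma hasDerivAt_log_sq_profile {t : ℝ}
    (ht : 0 < cosh (aConst * t) + √2 * sinh (aConst * t)) :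
    HasDerivAt (fun t => log ((cosh (aConst * t) + √2 * sinh (aConst * t)) ^ 2))
      (wSlope t) t := by
  refine (((hasDerivAt_cosh_add_const_mul_sinh aConst (√2) t).pow 2).log
    (pow_ne_zero 2 ht.ne')).congr_deriv ?_
  rw [wSlope]
  have := ht.ne'
  simp only [Pi.pow_apply]
  field_simp
  norm_num
  ring

lemma px_wSol {x y : ℝ} (h : (x, y) ∈ USol) : px wSol x y = wSlope (x - y) :=
  ((hasDerivAt_log_sq_profile (t := x - y) h).comp_sub_const x y).deriv

lemma py_wSol {x y : ℝ} (h : (x, y) ∈ USol) : py wSol x y = -wSlope (x - y) :=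
  ((hasDerivAt_log_sq_profile (t := x - y) h).comp_const_sub x y).deriv

lemma isOpen_USol : IsOpen USol := by
  refine isOpen_lt continuous_const ?_
  have h : Continuous fun p : ℝ × ℝ => aConst * (p.1 - p.2) := by fun_prop
  exact (Real.continuous_cosh.comp h).add
    (continuous_const.mul (Real.continuous_sinh.comp h))

lemma diag_mem_USol (x : ℝ) : (x, x) ∈ USol := by
  simp [USol]

open Real in
lemma sq_sinh_add_sqrt_two_mul_cosh (s : ℝ) :
    (sinh s + √2 * cosh s) ^ 2 = (cosh s + √2 * sinh s) ^ 2 + 1 := by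
  have h2 : √2 ^ 2 = 2 := sq_sqrt zero_le_two
  linear_combination (cosh s ^ 2 - sinh s ^ 2) * h2 + cosh_sq s

open Real in
lemma hasDerivAt_wSlope {t : ℝ}
    (ht : 0 < cosh (aConst * t) + √2 * sinh (aConst * t)) :
    HasDerivAt wSlope
      (-(2 * aConst ^ 2) / (cosh (aConst * t) + √2 * sinh (aConst * t)) ^ 2) t := by
  refine (((hasDerivAt_sinh_add_const_mul_cosh aConst (√2) t).div
    (hasDerivAt_cosh_add_const_mul_sinh aConst (√2) t) ht.ne').const_mul
      (2 * aConst)).congr_deriv ?_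
  rw [← mul_div_assoc]
  congr 1
  linear_combination (-2 * aConst ^ 2) * sq_sinh_add_sqrt_two_mul_cosh (aConst * t)

open Real in
lemma pxy_wSol {x y : ℝ} (h : (x, y) ∈ USol) :
    pxy wSol x y =
      2 * aConst ^ 2 / (cosh (aConst * (x - y)) + √2 * sinh (aConst * (x - y))) ^ 2 := by
  have hev : (fun y' => px wSol x y') =ᶠ[nhds y] fun y' => wSlope (x - y') := by
    have hc : ContinuousAt (fun y' : ℝ => (x, y')) y := by fun_prop
    filter_upwards [hc.preimage_mem_nhds (isOpen_USol.mem_nhds h)] with y' hy'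
    exact px_wSol hy'
  rw [pxy, hev.deriv_eq, ((hasDerivAt_wSlope (t := x - y) h).comp_const_sub x y).deriv]
  ring

lemma exp_wSol {x y : ℝ} (h : (x, y) ∈ USol) :
    Real.exp (wSol x y) =
      (Real.cosh (aConst * (x - y)) + Real.sqrt 2 * Real.sinh (aConst * (x - y))) ^ 2 :=
  Real.exp_log (pow_pos h 2)

lemma wSol_equation {x y : ℝ} (h : (x, y) ∈ USol) :
    pxy wSol x y + px wSol x y * py wSol x y /
      (2 * (1 + Real.exp ((wSol x y + wSol x y) / 2))) = 0 := by
  rw [add_self_div_two, exp_wSol h, pxy_wSol h, px_wSol h, py_wSol h, wSlope]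
  have hid := sq_sinh_add_sqrt_two_mul_cosh (aConst * (x - y))
  have hf : 0 < Real.cosh (aConst * (x - y)) + Real.sqrt 2 * Real.sinh (aConst * (x - y)) := h
  generalize Real.cosh (aConst * (x - y)) + Real.sqrt 2 * Real.sinh (aConst * (x - y)) = f at *
  generalize Real.sinh (aConst * (x - y)) + Real.sqrt 2 * Real.cosh (aConst * (x - y)) = g at *
  have h1 : 1 + f ^ 2 ≠ 0 := by positivity
  field_simp
  linear_combination (-2 * aConst ^ 2) * hid

lemma wSlope_zero : wSlope 0 = 1 := by
  have h2 : Real.sqrt 2 ^ 2 = 2 := Real.sq_sqrt zero_le_two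
  simp only [wSlope, aConst, mul_zero, Real.sinh_zero, Real.cosh_zero]
  linear_combination h2 / 2

/-- the explicit pair `u = v = wSol` solves (WM) on `USol`, an open set
containing the diagonal, with Cauchy data `u = v = 0`, `u_x = v_x = 1`, `u_y = v_y = -1`
along `y = x` (i.e. normal derivative `√2` in the direction `n = (1,-1)/√2`). -/
theorem explicit_solution_constant_data :
    IsOpen USol ∧ (∀ x : ℝ, (x, x) ∈ USol) ∧
    IsWaveMap USol wSol wSol ∧
    ∀ x : ℝ, wSol x x = 0 ∧ px wSol x x = 1 ∧ py wSol x x = -1 := by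
  refine ⟨isOpen_USol, diag_mem_USol, fun p hp => ⟨wSol_equation hp, wSol_equation hp⟩,
    fun x => ⟨by simp [wSol], ?_, ?_⟩⟩
  · rw [px_wSol (diag_mem_USol x), sub_self, wSlope_zero]
  · rw [py_wSol (diag_mem_USol x), sub_self, wSlope_zero]
end

section
/- Fix λ > 0. Define A(x,y) = λ e^{(x+y)/4} ( e^{−y/2}(3+2√2) − e^{−x/2} ) / (2(1+√2)) and B(x,y) = (1/(2λ)) e^{(x+y)/4} ( e^{−y}(2√2+3) − e^{−x}(2√2−3) − 2 e^{−(x+y)/2} ) / ( e^{−y/2}(1+√2) + e^{−x/2}(1−√2) ). On the open set U ⊆ ℝ² where A > 0, B > 0 and e^{−y/2}(1+√2) + e^{−x/2}(1−√2) ≠ 0 (a set containing the diagonal y = x), put u = 2 ln A and v = 2 ln B. Then (u, v) is a solution of the wave map system (WM) on U and satisfies the Cauchy data along the diagonal: u(x,x) = 2 ln λ, v(x,x) = −2 ln λ, u_x(x,x) − u_y(x,x) = √2 and v_x(x,x) − v_y(x,x) = √2 for all x ∈ ℝ (i.e. the derivatives of u and v in the unit normal direction n = (1,−1)/√2 along y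 = x both equal 1). -/
/-- `A(x,y) = λ e^{(x+y)/4} ( e^{-y/2}(3+2√2) - e^{-x/2} ) / (2(1+√2))`. -/
noncomputable def Afun (lam x y : ℝ) : ℝ :=
  lam * Real.exp ((x + y) / 4) *
      (Real.exp (-y / 2) * (3 + 2 * Real.sqrt 2) - Real.exp (-x / 2)) /
    (2 * (1 + Real.sqrt 2))

/-- `B(x,y) = (1/(2λ)) e^{(x+y)/4} ( e^{-y}(2√2+3) - e^{-x}(2√2-3) - 2e^{-(x+y)/2} )
  / ( e^{-y/2}(1+√2) + e^{-x/2}(1-√2) )`. -/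
noncomputable def Bfun (lam x y : ℝ) : ℝ :=
  (1 / (2 * lam)) * Real.exp ((x + y) / 4) *
      (Real.exp (-y) * (2 * Real.sqrt 2 + 3) - Real.exp (-x) * (2 * Real.sqrt 2 - 3) -
        2 * Real.exp (-(x + y) / 2)) /
    (Real.exp (-y / 2) * (1 + Real.sqrt 2) + Real.exp (-x / 2) * (1 - Real.sqrt 2))

/-- The open set where `A > 0`, `B > 0` and the denominator of `B` is nonzero. -/
def UAB (lam : ℝ) : Set (ℝ × ℝ) :=
  {p : ℝ × ℝ | 0 < Afun lam p.1 p.2 ∧ 0 < Bfun lam p.1 p.2 ∧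
    Real.exp (-p.2 / 2) * (1 + Real.sqrt 2) + Real.exp (-p.1 / 2) * (1 - Real.sqrt 2) ≠ 0}

open Real in
theorem exp_arsinh_one : exp (arsinh 1) = 1 + √2 := by
  rw [exp_arsinh]; norm_num

open Real in
theorem exp_neg_arsinh_one : exp (-arsinh 1) = √2 - 1 := by
  have h : √2 * √2 = 2 := mul_self_sqrt (by norm_num)
  rw [exp_neg, exp_arsinh_one]
  refine inv_eq_of_mul_eq_one_right ?_
  linear_combination h

open Real in
theorem sinh_sub_div_four_add_arsinh_one (x y : ℝ) :
    sinh ((x - y) / 4 + arsinh 1) = exp ((x + y) / 4) *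
      (exp (-y / 2) * (1 + √2) + exp (-x / 2) * (1 - √2)) / 2 := by
  have h₁ : exp ((x - y) / 4) = exp ((x + y) / 4) * exp (-y / 2) := by
    rw [← exp_add]; ring_nf
  have h₂ : exp (-((x - y) / 4)) = exp ((x + y) / 4) * exp (-x / 2) := by
    rw [← exp_add]; ring_nf
  rw [sinh_eq, neg_add, exp_add, exp_add, exp_arsinh_one, exp_neg_arsinh_one, h₁, h₂]
  ring

theorem Afun_eq (lam x y : ℝ) :
    Afun lam x y = lam * Real.sinh ((x - y) / 4 + Real.arsinh 1) := by
  have h : √2 * √2 = 2 := Real.mul_self_sqrt (by norm_num)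
  have h' : 2 * (1 + √2) ≠ 0 := by positivity
  rw [sinh_sub_div_four_add_arsinh_one, Afun, div_eq_iff h']
  linear_combination (lam * Real.exp ((x + y) / 4) *
    (Real.exp (-x / 2) - Real.exp (-y / 2))) * h

theorem Bfun_eq (lam x y : ℝ) :
    Bfun lam x y = lam⁻¹ * Real.sinh ((x - y) / 4 + Real.arsinh 1) := by
  have h : √2 * √2 = 2 := Real.mul_self_sqrt (by norm_num)
  have hy : Real.exp (-y) = Real.exp (-y / 2) ^ 2 := by rw [← Real.exp_nat_mul]; ring_nf
  have hx : Real.exp (-x) = Real.exp (-x / 2) ^ 2 := by rw [← Real.exp_nat_mul]; ring_nf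
  have hxy : Real.exp (-(x + y) / 2) = Real.exp (-x / 2) * Real.exp (-y / 2) := by
    rw [← Real.exp_add]; ring_nf
  rw [sinh_sub_div_four_add_arsinh_one, Bfun, hy, hx, hxy]
  set a := Real.exp (-x / 2)
  set b := Real.exp (-y / 2)
  have hsq : b ^ 2 * (2 * √2 + 3) - a ^ 2 * (2 * √2 - 3) - 2 * (a * b) =
      (b * (1 + √2) + a * (1 - √2)) * (b * (1 + √2) + a * (1 - √2)) := by
    linear_combination -(a - b) ^ 2 * h
  rw [hsq, mul_div_assoc, mul_self_div_self, one_div, mul_inv]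
  ring

theorem hasDerivAt_two_mul_log_mul_sinh {c : ℝ} (hc : c ≠ 0) {θ : ℝ → ℝ} {θ' t : ℝ}
    (hθ : HasDerivAt θ θ' t) (ht : Real.sinh (θ t) ≠ 0) :
    HasDerivAt (fun s => 2 * Real.log (c * Real.sinh (θ s)))
      (2 * θ' * Real.cosh (θ t) / Real.sinh (θ t)) t := by
  refine (((hθ.sinh.const_mul c).log (mul_ne_zero hc ht)).const_mul 2).congr_deriv ?_
  rw [mul_div_mul_left _ _ hc]
  ring

theorem hasDerivAt_phase_left (x y : ℝ) :
    HasDerivAt (fun t : ℝ => (t - y) / 4 + Real.arsinh 1) (1 / 4) x :=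
  (((hasDerivAt_id x).sub_const y).div_const 4).add_const _

theorem hasDerivAt_phase_right (x y : ℝ) :
    HasDerivAt (fun t : ℝ => (x - t) / 4 + Real.arsinh 1) (-1 / 4) y :=
  (((hasDerivAt_id y).const_sub x).div_const 4).add_const _

theorem px_two_mul_log_mul_sinh {c : ℝ} (hc : c ≠ 0) {x y : ℝ}
    (h : Real.sinh ((x - y) / 4 + Real.arsinh 1) ≠ 0) :
    px (fun x y => 2 * Real.log (c * Real.sinh ((x - y) / 4 + Real.arsinh 1))) x y =
      Real.cosh ((x - y) / 4 + Real.arsinh 1) /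
        (2 * Real.sinh ((x - y) / 4 + Real.arsinh 1)) := by
  refine (hasDerivAt_two_mul_log_mul_sinh hc (hasDerivAt_phase_left x y) h).deriv.trans ?_
  field_simp
  norm_num

theorem py_two_mul_log_mul_sinh {c : ℝ} (hc : c ≠ 0) {x y : ℝ}
    (h : Real.sinh ((x - y) / 4 + Real.arsinh 1) ≠ 0) :
    py (fun x y => 2 * Real.log (c * Real.sinh ((x - y) / 4 + Real.arsinh 1))) x y =
      -(Real.cosh ((x - y) / 4 + Real.arsinh 1) /
        (2 * Real.sinh ((x - y) / 4 + Real.arsinh 1))) := by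
  refine (hasDerivAt_two_mul_log_mul_sinh hc (hasDerivAt_phase_right x y) h).deriv.trans ?_
  field_simp
  norm_num

theorem pxy_two_mul_log_mul_sinh {c : ℝ} (hc : c ≠ 0) {x y : ℝ}
    (h : Real.sinh ((x - y) / 4 + Real.arsinh 1) ≠ 0) :
    pxy (fun x y => 2 * Real.log (c * Real.sinh ((x - y) / 4 + Real.arsinh 1))) x y =
      1 / (8 * Real.sinh ((x - y) / 4 + Real.arsinh 1) ^ 2) := by
  have hcont : ContinuousAt (fun t : ℝ => Real.sinh ((x - t) / 4 + Real.arsinh 1)) y :=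
    (hasDerivAt_phase_right x y).sinh.continuousAt
  have heq := (hcont.eventually_ne h).mono fun t ht => px_two_mul_log_mul_sinh hc ht
  have hd := (hasDerivAt_phase_right x y).cosh.div
    ((hasDerivAt_phase_right x y).sinh.const_mul 2) (mul_ne_zero two_ne_zero h)
  refine (Filter.EventuallyEq.deriv_eq heq).trans (hd.deriv.trans ?_)
  have hcs := Real.cosh_sq ((x - y) / 4 + Real.arsinh 1)
  rw [div_eq_div_iff (by positivity) (by positivity)]
  linear_combination 4 * Real.sinh ((x - y) / 4 + Real.arsinh 1) ^ 2 * hcs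

theorem wave_equation_two_mul_log_mul_sinh {c d : ℝ} (hc : c ≠ 0) {x y : ℝ}
    (h : Real.sinh ((x - y) / 4 + Real.arsinh 1) ≠ 0)
    (hd : d = Real.sinh ((x - y) / 4 + Real.arsinh 1) ^ 2) :
    pxy (fun x y => 2 * Real.log (c * Real.sinh ((x - y) / 4 + Real.arsinh 1))) x y +
      px (fun x y => 2 * Real.log (c * Real.sinh ((x - y) / 4 + Real.arsinh 1))) x y *
      py (fun x y => 2 * Real.log (c * Real.sinh ((x - y) / 4 + Real.arsinh 1))) x y /
        (2 * (1 + d)) = 0 := by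
  have hcosh := (Real.cosh_pos ((x - y) / 4 + Real.arsinh 1)).ne'
  have hcs : 1 + d = Real.cosh ((x - y) / 4 + Real.arsinh 1) ^ 2 := by
    rw [hd, Real.cosh_sq]; ring
  rw [pxy_two_mul_log_mul_sinh hc h, px_two_mul_log_mul_sinh hc h,
    py_two_mul_log_mul_sinh hc h, hcs]
  field_simp
  norm_num

theorem mem_UAB_iff {lam : ℝ} (hlam : 0 < lam) (p : ℝ × ℝ) :
    p ∈ UAB lam ↔ 0 < Real.sinh ((p.1 - p.2) / 4 + Real.arsinh 1) := by
  simp only [UAB, Set.mem_ofPred_eq, Afun_eq, Bfun_eq]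
  refine ⟨fun h => pos_of_mul_pos_right h.1 hlam.le, fun h => ⟨by positivity, by positivity, ?_⟩⟩
  rw [sinh_sub_div_four_add_arsinh_one] at h
  intro h0
  simp [h0] at h

/-- `u = 2 ln A`, `v = 2 ln B` solve (WM) on `UAB lam`, an open set
containing the diagonal, with Cauchy data `u(x,x) = 2 ln λ`, `v(x,x) = -2 ln λ`,
`u_x - u_y = √2` and `v_x - v_y = √2` along `y = x`. -/
theorem explicit_solution_lambda_data (lam : ℝ) (hlam : 0 < lam) :
    IsOpen (UAB lam) ∧ (∀ x : ℝ, (x, x) ∈ UAB lam) ∧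
    IsWaveMap (UAB lam)
      (fun x y => 2 * Real.log (Afun lam x y))
      (fun x y => 2 * Real.log (Bfun lam x y)) ∧
    ∀ x : ℝ,
      2 * Real.log (Afun lam x x) = 2 * Real.log lam ∧
      2 * Real.log (Bfun lam x x) = -(2 * Real.log lam) ∧
      px (fun x y => 2 * Real.log (Afun lam x y)) x x -
        py (fun x y => 2 * Real.log (Afun lam x y)) x x = Real.sqrt 2 ∧
      px (fun x y => 2 * Real.log (Bfun lam x y)) x x -
        py (fun x y => 2 * Real.log (Bfun lam x y)) x x = Real.sqrt 2 := by
  have hlam' : lam ≠ 0 := hlam.ne'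
  have hdiag (x : ℝ) : Real.sinh ((x - x) / 4 + Real.arsinh 1) = 1 := by simp
  have hdiag' (x : ℝ) : Real.cosh ((x - x) / 4 + Real.arsinh 1) = √2 := by
    simp [Real.cosh_arsinh]; norm_num
  have hne (x : ℝ) : Real.sinh ((x - x) / 4 + Real.arsinh 1) ≠ 0 := by
    rw [hdiag]; exact one_ne_zero
  refine ⟨?_, fun x => ?_, fun p hp => ?_, fun x => ?_⟩
  · have hU : UAB lam = {p | 0 < Real.sinh ((p.1 - p.2) / 4 + Real.arsinh 1)} :=
      Set.ext (mem_UAB_iff hlam)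
    rw [hU]
    exact isOpen_lt continuous_const (Real.continuous_sinh.comp (by fun_prop))
  · rw [mem_UAB_iff hlam, hdiag]
    exact one_pos
  · rw [mem_UAB_iff hlam] at hp
    simp only [Afun_eq, Bfun_eq]
    have hexp : Real.exp ((2 * Real.log (lam * Real.sinh ((p.1 - p.2) / 4 + Real.arsinh 1)) +
        2 * Real.log (lam⁻¹ * Real.sinh ((p.1 - p.2) / 4 + Real.arsinh 1))) / 2) =
        Real.sinh ((p.1 - p.2) / 4 + Real.arsinh 1) ^ 2 := by
      rw [← mul_add, mul_div_cancel_left₀ _ two_ne_zero, Real.exp_add,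
        Real.exp_log (by positivity), Real.exp_log (by positivity)]
      field_simp
    exact ⟨wave_equation_two_mul_log_mul_sinh hlam' hp.ne' hexp,
      wave_equation_two_mul_log_mul_sinh (inv_ne_zero hlam') hp.ne' hexp⟩
  · simp only [Afun_eq, Bfun_eq]
    rw [px_two_mul_log_mul_sinh hlam' (hne x), py_two_mul_log_mul_sinh hlam' (hne x),
      px_two_mul_log_mul_sinh (inv_ne_zero hlam') (hne x),
      py_two_mul_log_mul_sinh (inv_ne_zero hlam') (hne x), hdiag, hdiag']
    refine ⟨by rw [mul_one], by rw [mul_one, Real.log_inv]; ring, by ring, by ring⟩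
end

section
/- (Hyperbolic Weierstrass representation.) Let f₂, g₂ : ℝ → ℝ be twice continuously differentiable and define F(s,t) = ( (t g₂(t) − 1) f₂′(s) + (2 t g₂(t) − 1) f₂(s)² ) / ( g₂(t) ( f₂(s) + s f₂′(s) ) ) and G(s,t) = ( (s f₂(s) − 1) g₂′(t) + (2 s f₂(s) − 1) g₂(t)² ) / ( f₂(s) ( g₂(t) + t g₂′(t) ) ). Let Ω ⊆ ℝ² be any open set on which F > 0, G > 0 and the denominators g₂(t)(f₂(s)+s f₂′(s)) and f₂(s)(g₂(t)+t g₂′(t)) are nonzero, and set u = 2 ln F, v = 2 ln G on Ω. Then (u, v) satisfies on Ω the wave map system in the characteristic coordinates (s, t): ∂²u/∂s∂t + (∂u/∂s)(∂u/∂t)/(2(1 + exp((u+v)/2))) = 0 and ∂²v/∂s∂t + (∂v/∂s)(∂v/∂t)/(2(1 + exp((u+v)/2))) = 0, where exp((u+v)/2) = F·G. Consequently, for any C² reparametrizations x = f₁(s), y = g₁(t) with nowhere vanishing derivatives, these formulas define harmonic (wave) maps from (ℝ^{1,1}, dx dy) into the metric (du₁² − du₂²)/(1 + e^{−u₁}).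 -/
/-- `F(s,t) = ((t g₂(t) - 1) f₂'(s) + (2t g₂(t) - 1) f₂(s)²) / (g₂(t)(f₂(s) + s f₂'(s)))`. -/
noncomputable def Wrep₁ (f₂ g₂ : ℝ → ℝ) (s t : ℝ) : ℝ :=
  ((t * g₂ t - 1) * deriv f₂ s + (2 * t * g₂ t - 1) * f₂ s ^ 2) /
    (g₂ t * (f₂ s + s * deriv f₂ s))

/-- `G(s,t) = ((s f₂(s) - 1) g₂'(t) + (2s f₂(s) - 1) g₂(t)²) / (f₂(s)(g₂(t) + t g₂'(t)))`. -/
noncomputable def Wrep₂ (f₂ g₂ : ℝ → ℝ) (s t : ℝ) : ℝ :=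
  ((s * f₂ s - 1) * deriv g₂ t + (2 * s * f₂ s - 1) * g₂ t ^ 2) /
    (f₂ s * (g₂ t + t * deriv g₂ t))

open Filter Topology

/-- Differentiation of a function known only through its composition with a local
diffeomorphism of the line. -/
lemma hasDerivAt_of_eventually_comp_eq {h w W : ℝ → ℝ} {a W' : ℝ} (hh : ContDiff ℝ 2 h)
    (ha : deriv h a ≠ 0) (hw : ∀ᶠ s in 𝓝 a, w (h s) = W s) (hW : HasDerivAt W W' a) :
    HasDerivAt w (W' / deriv h a) (h a) := by
  have hs : HasStrictDerivAt h (deriv h a) a :=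
    hh.contDiffAt.hasStrictDerivAt (by norm_num)
  have hinv := (hs.to_localInverse ha).hasDerivAt
  have hleft : hs.localInverse h (deriv h a) a ha (h a) = a :=
    (hs.hasStrictFDerivAt_equiv ha).localInverse_apply_image
  have hcont := hinv.continuousAt
  have hright : ∀ᶠ x in 𝓝 (h a), h (hs.localInverse h (deriv h a) a ha x) = x :=
    (hs.hasStrictFDerivAt_equiv ha).eventually_right_inverse
  rw [ContinuousAt, hleft] at hcont
  have hcomp := HasDerivAt.comp (h a) (hleft.symm ▸ hW) hinv
  rw [← div_eq_mul_inv] at hcomp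
  refine hcomp.congr_of_eventuallyEq ?_
  filter_upwards [hcont.eventually hw, hright] with x hx hx'
  rw [hx'] at hx
  exact hx

/-- The derivatives of `u`, where `u (h s) (k t) = 2 log (X₁(s) A₁(t) + X₂(s) A₂(t))`. -/
lemma partials_of_two_mul_log_separable {Ω : Set (ℝ × ℝ)} (hΩ : IsOpen Ω) {h k : ℝ → ℝ}
    (hh : ContDiff ℝ 2 h) (hk : ContDiff ℝ 2 k) (hh0 : ∀ s, deriv h s ≠ 0)
    (hk0 : ∀ t, deriv k t ≠ 0) {u W : ℝ → ℝ → ℝ}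
    (hu : ∀ p ∈ Ω, u (h p.1) (k p.2) = 2 * Real.log (W p.1 p.2))
    (hW0 : ∀ p ∈ Ω, 0 < W p.1 p.2)
    {X₁ X₂ A₁ A₂ X₁' X₂' A₁' A₂' : ℝ → ℝ}
    (hW : ∀ p ∈ Ω, W p.1 p.2 = X₁ p.1 * A₁ p.2 + X₂ p.1 * A₂ p.2)
    (hX₁ : ∀ p ∈ Ω, HasDerivAt X₁ (X₁' p.1) p.1) (hX₂ : ∀ p ∈ Ω, HasDerivAt X₂ (X₂' p.1) p.1)
    (hA₁ : ∀ p ∈ Ω, HasDerivAt A₁ (A₁' p.2) p.2) (hA₂ : ∀ p ∈ Ω, HasDerivAt A₂ (A₂' p.2) p.2)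
    {s t : ℝ} (hp : (s, t) ∈ Ω) :
    px u (h s) (k t) =
        2 * ((X₁' s * A₁ t + X₂' s * A₂ t) / W s t) / deriv h s ∧
    py u (h s) (k t) =
        2 * ((X₁ s * A₁' t + X₂ s * A₂' t) / W s t) / deriv k t ∧
    pxy u (h s) (k t) =
        2 * (((X₁' s * A₁' t + X₂' s * A₂' t) * W s t -
          (X₁' s * A₁ t + X₂' s * A₂ t) * (X₁ s * A₁' t + X₂ s * A₂' t)) / W s t ^ 2) /
          deriv h s / deriv k t := by
  have near_s : ∀ {s t : ℝ}, (s, t) ∈ Ω → ∀ᶠ s' in 𝓝 s, (s', t) ∈ Ω := fun {s t} hp =>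
    (Continuous.prodMk_left t).continuousAt.eventually (hΩ.mem_nhds hp)
  have near_t : ∀ᶠ t' in 𝓝 t, (s, t') ∈ Ω :=
    (Continuous.prodMk_right s).continuousAt.eventually (hΩ.mem_nhds hp)
  have hWt : HasDerivAt (fun t' => W s t') (X₁ s * A₁' t + X₂ s * A₂' t) t :=
    (((hA₁ _ hp).const_mul (X₁ s)).add ((hA₂ _ hp).const_mul (X₂ s))).congr_of_eventuallyEq
      (near_t.mono fun t' ht' => hW _ ht')
  have hpx : ∀ {s t : ℝ}, (s, t) ∈ Ω → px u (h s) (k t) =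
      2 * ((X₁' s * A₁ t + X₂' s * A₂ t) / W s t) / deriv h s := by
    intro s t hp
    have hWs : HasDerivAt (fun s' => W s' t) (X₁' s * A₁ t + X₂' s * A₂ t) s :=
      (((hX₁ _ hp).mul_const (A₁ t)).add ((hX₂ _ hp).mul_const (A₂ t))).congr_of_eventuallyEq
        ((near_s hp).mono fun s' hs' => hW _ hs')
    exact (hasDerivAt_of_eventually_comp_eq (w := fun x => u x (k t)) hh (hh0 s)
      ((near_s hp).mono fun s' hs' => hu _ hs')
      ((hWs.log (hW0 _ hp).ne').const_mul 2)).deriv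
  refine ⟨hpx hp, ?_, ?_⟩
  · exact (hasDerivAt_of_eventually_comp_eq (w := fun y => u (h s) y) hk (hk0 t)
      (near_t.mono fun t' ht' => hu _ ht')
      ((hWt.log (hW0 _ hp).ne').const_mul 2)).deriv
  · exact (hasDerivAt_of_eventually_comp_eq (w := fun y => px u (h s) y) hk (hk0 t)
      (near_t.mono fun t' ht' => hpx ht')
      ((((((hA₁ _ hp).const_mul (X₁' s)).add ((hA₂ _ hp).const_mul (X₂' s))).div hWt
        (hW0 _ hp).ne').const_mul 2).div_const (deriv h s))).deriv

lemma hasDerivAt_deriv_div {f : ℝ → ℝ} (hf : ContDiff ℝ 2 f) {s : ℝ}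
    (hs : f s + s * deriv f s ≠ 0) :
    HasDerivAt (fun s => deriv f s / (f s + s * deriv f s))
      ((f s * deriv (deriv f) s - 2 * deriv f s ^ 2) / (f s + s * deriv f s) ^ 2) s := by
  have h1 : HasDerivAt f (deriv f s) s := (hf.differentiable (by norm_num) s).hasDerivAt
  have h2 : HasDerivAt (deriv f) (deriv (deriv f) s) s :=
    (hf.differentiable_deriv_two s).hasDerivAt
  refine (h2.fun_div (h1.fun_add ((hasDerivAt_id' s).fun_mul h2)) hs).congr_deriv ?_
  ring

lemma hasDerivAt_sq_div {f : ℝ → ℝ} (hf : ContDiff ℝ 2 f) {s : ℝ}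
    (hs : f s + s * deriv f s ≠ 0) :
    HasDerivAt (fun s => f s ^ 2 / (f s + s * deriv f s))
      (-(s * f s) * ((f s * deriv (deriv f) s - 2 * deriv f s ^ 2) /
        (f s + s * deriv f s) ^ 2)) s := by
  have h1 : HasDerivAt f (deriv f s) s := (hf.differentiable (by norm_num) s).hasDerivAt
  have h2 : HasDerivAt (deriv f) (deriv (deriv f) s) s :=
    (hf.differentiable_deriv_two s).hasDerivAt
  refine ((h1.fun_pow 2).fun_div (h1.fun_add ((hasDerivAt_id' s).fun_mul h2)) hs).congr_deriv ?_
  push_cast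
  ring

lemma hasDerivAt_const_mul_sub_inv {g : ℝ → ℝ} (hg : ContDiff ℝ 2 g) (c : ℝ) {t : ℝ}
    (ht : g t ≠ 0) :
    HasDerivAt (fun t => c * t - (g t)⁻¹) (c + deriv g t / g t ^ 2) t := by
  have h1 : HasDerivAt g (deriv g t) t := (hg.differentiable (by norm_num) t).hasDerivAt
  refine (((hasDerivAt_id' t).const_mul c).fun_sub (h1.fun_inv ht)).congr_deriv ?_
  ring

lemma Wrep₁_eq_separable {f g : ℝ → ℝ} {s t : ℝ} (h : g t * (f s + s * deriv f s) ≠ 0) :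
    Wrep₁ f g s t = deriv f s / (f s + s * deriv f s) * (1 * t - (g t)⁻¹) +
      f s ^ 2 / (f s + s * deriv f s) * (2 * t - (g t)⁻¹) := by
  have hg := left_ne_zero_of_mul h
  have hf := right_ne_zero_of_mul h
  rw [Wrep₁]
  field_simp

lemma Wrep₂_eq_Wrep₁_swap (f g : ℝ → ℝ) (s t : ℝ) : Wrep₂ f g s t = Wrep₁ g f t s := rfl

/-- The algebraic identity `(1 + F G) F_{st} = G F_s F_t` in jet coordinates. -/
lemma weierstrass_identity {a b p q s t K : ℝ} (ha : a ≠ 0) (hp : p ≠ 0)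
    (hD : a + s * b ≠ 0) (hE : p + t * q ≠ 0) :
    (1 + (((t * p - 1) * b + (2 * t * p - 1) * a ^ 2) / (p * (a + s * b))) *
        (((s * a - 1) * q + (2 * s * a - 1) * p ^ 2) / (a * (p + t * q)))) *
      (K * (1 + q / p ^ 2) + -(s * a) * K * (2 + q / p ^ 2)) =
    ((s * a - 1) * q + (2 * s * a - 1) * p ^ 2) / (a * (p + t * q)) *
      (K * (1 * t - p⁻¹) + -(s * a) * K * (2 * t - p⁻¹)) *
      (b / (a + s * b) * (1 + q / p ^ 2) + a ^ 2 / (a + s * b) * (2 + q / p ^ 2)) := by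
  obtain ⟨D, hD'⟩ : ∃ D, D = a + s * b := ⟨_, rfl⟩
  obtain ⟨E, hE'⟩ : ∃ E, E = p + t * q := ⟨_, rfl⟩
  rw [← hD'] at hD ⊢
  rw [← hE'] at hE ⊢
  field_simp
  rw [hD', hE']
  ring

lemma wave_equation_of_jets {F G Fs Ft Fst m n : ℝ} (hF : 0 < F) (hG : 0 < G)
    (hm : m ≠ 0) (hn : n ≠ 0) (h : (1 + F * G) * Fst = G * Fs * Ft) :
    2 * ((Fst * F - Fs * Ft) / F ^ 2) / m / n +
      2 * (Fs / F) / m * (2 * (Ft / F) / n) / (2 * (1 + F * G)) = 0 := by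
  have hFG : 1 + F * G ≠ 0 := by positivity
  field_simp
  linear_combination 2 * F * h

lemma exp_half_two_mul_log_add {F G : ℝ} (hF : 0 < F) (hG : 0 < G) :
    Real.exp ((2 * Real.log F + 2 * Real.log G) / 2) = F * G := by
  rw [← mul_add, mul_div_cancel_left₀ _ two_ne_zero, Real.exp_add, Real.exp_log hF,
    Real.exp_log hG]

lemma isWaveMap_image_of_eq_two_mul_log {f₂ g₂ : ℝ → ℝ} (hf₂ : ContDiff ℝ 2 f₂)
    (hg₂ : ContDiff ℝ 2 g₂) {Ω : Set (ℝ × ℝ)} (hΩ : IsOpen Ω)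
    (hF : ∀ p ∈ Ω, 0 < Wrep₁ f₂ g₂ p.1 p.2)
    (hG : ∀ p ∈ Ω, 0 < Wrep₂ f₂ g₂ p.1 p.2)
    (hden₁ : ∀ p ∈ Ω, g₂ p.2 * (f₂ p.1 + p.1 * deriv f₂ p.1) ≠ 0)
    (hden₂ : ∀ p ∈ Ω, f₂ p.1 * (g₂ p.2 + p.2 * deriv g₂ p.2) ≠ 0)
    {f₁ g₁ : ℝ → ℝ} (hf₁ : ContDiff ℝ 2 f₁) (hg₁ : ContDiff ℝ 2 g₁)
    (hf₁0 : ∀ s, deriv f₁ s ≠ 0) (hg₁0 : ∀ t, deriv g₁ t ≠ 0) {u v : ℝ → ℝ → ℝ}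
    (hu : ∀ p ∈ Ω, u (f₁ p.1) (g₁ p.2) = 2 * Real.log (Wrep₁ f₂ g₂ p.1 p.2))
    (hv : ∀ p ∈ Ω, v (f₁ p.1) (g₁ p.2) = 2 * Real.log (Wrep₂ f₂ g₂ p.1 p.2)) :
    IsWaveMap ((fun p : ℝ × ℝ => (f₁ p.1, g₁ p.2)) '' Ω) u v := by
  rintro _ ⟨⟨s, t⟩, hp, rfl⟩
  have hexp := exp_half_two_mul_log_add (hF _ hp) (hG _ hp)
  rw [← hu _ hp, ← hv _ hp] at hexp
  have hg0 := fun p hp => left_ne_zero_of_mul (hden₁ p hp)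
  have hD0 := fun p hp => right_ne_zero_of_mul (hden₁ p hp)
  have hf0 := fun p hp => left_ne_zero_of_mul (hden₂ p hp)
  have hE0 := fun p hp => right_ne_zero_of_mul (hden₂ p hp)
  obtain ⟨hux, huy, huxy⟩ := partials_of_two_mul_log_separable hΩ hf₁ hg₁ hf₁0 hg₁0 hu hF
    (X₁' := fun s => (f₂ s * deriv (deriv f₂) s - 2 * deriv f₂ s ^ 2) /
        (f₂ s + s * deriv f₂ s) ^ 2)
    (X₁ := fun s => deriv f₂ s / (f₂ s + s * deriv f₂ s))
    (X₂ := fun s => f₂ s ^ 2 / (f₂ s + s * deriv f₂ s))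
    (A₁ := fun t => 1 * t - (g₂ t)⁻¹) (A₂ := fun t => 2 * t - (g₂ t)⁻¹)
    (fun p hp => Wrep₁_eq_separable (hden₁ p hp))
    (fun p hp => hasDerivAt_deriv_div hf₂ (hD0 p hp))
    (X₂' := fun s => -(s * f₂ s) * ((f₂ s * deriv (deriv f₂) s - 2 * deriv f₂ s ^ 2) /
        (f₂ s + s * deriv f₂ s) ^ 2))
    (fun p hp => hasDerivAt_sq_div hf₂ (hD0 p hp))
    (A₁' := fun t => 1 + deriv g₂ t / g₂ t ^ 2) (A₂' := fun t => 2 + deriv g₂ t / g₂ t ^ 2)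
    (fun p hp => hasDerivAt_const_mul_sub_inv hg₂ 1 (hg0 p hp))
    (fun p hp => hasDerivAt_const_mul_sub_inv hg₂ 2 (hg0 p hp)) hp
  obtain ⟨hvx, hvy, hvxy⟩ := partials_of_two_mul_log_separable hΩ hf₁ hg₁ hf₁0 hg₁0 hv hG
    (X₁ := fun s => 1 * s - (f₂ s)⁻¹) (X₂ := fun s => 2 * s - (f₂ s)⁻¹)
    (A₁ := fun t => deriv g₂ t / (g₂ t + t * deriv g₂ t))
    (A₂ := fun t => g₂ t ^ 2 / (g₂ t + t * deriv g₂ t))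
    (X₁' := fun s => 1 + deriv f₂ s / f₂ s ^ 2) (X₂' := fun s => 2 + deriv f₂ s / f₂ s ^ 2)
    (A₁' := fun t => (g₂ t * deriv (deriv g₂) t - 2 * deriv g₂ t ^ 2) /
        (g₂ t + t * deriv g₂ t) ^ 2)
    (A₂' := fun t => -(t * g₂ t) * ((g₂ t * deriv (deriv g₂) t - 2 * deriv g₂ t ^ 2) /
        (g₂ t + t * deriv g₂ t) ^ 2))
    (fun p hp => by
      rw [Wrep₂_eq_Wrep₁_swap, Wrep₁_eq_separable (hden₂ p hp), mul_comm,
        mul_comm (2 * p.1 - _)])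
    (fun p hp => hasDerivAt_const_mul_sub_inv hf₂ 1 (hf0 p hp))
    (fun p hp => hasDerivAt_const_mul_sub_inv hf₂ 2 (hf0 p hp))
    (fun p hp => hasDerivAt_deriv_div hg₂ (hE0 p hp))
    (fun p hp => hasDerivAt_sq_div hg₂ (hE0 p hp)) hp
  dsimp only at hexp hux huy huxy hvx hvy hvxy ⊢
  rw [hexp, hux, huy, huxy, hvx, hvy, hvxy]
  refine ⟨wave_equation_of_jets (hF _ hp) (hG _ hp) (hf₁0 s) (hg₁0 t)
    (weierstrass_identity (hf0 _ hp) (hg0 _ hp) (hD0 _ hp) (hE0 _ hp)), ?_⟩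
  rw [mul_comm (Wrep₁ f₂ g₂ s t)]
  refine wave_equation_of_jets (hG _ hp) (hF _ hp) (hf₁0 s) (hg₁0 t) ?_
  have key := weierstrass_identity
    (K := (g₂ t * deriv (deriv g₂) t - 2 * deriv g₂ t ^ 2) / (g₂ t + t * deriv g₂ t) ^ 2)
    (hg0 _ hp) (hf0 _ hp) (hE0 _ hp) (hD0 _ hp)
  dsimp only at key
  rw [Wrep₁, Wrep₂]
  linear_combination key

/-- hyperbolic Weierstrass representation: `u = 2 ln F`, `v = 2 ln G`
satisfy the wave map system in the characteristic coordinates `(s,t)` on `Ω`, with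
`exp((u+v)/2) = F·G`; consequently, composing with any characteristic reparametrizations
`x = f₁(s)`, `y = g₁(t)` with nowhere vanishing derivatives yields wave maps from
`(ℝ^{1,1}, dx dy)` into `(du₁² - du₂²)/(1 + e^{-u₁})`. -/
theorem hyperbolic_weierstrass_representation
    (f₂ g₂ : ℝ → ℝ) (hf₂ : ContDiff ℝ 2 f₂) (hg₂ : ContDiff ℝ 2 g₂)
    (Ω : Set (ℝ × ℝ)) (hΩ : IsOpen Ω)
    (hF : ∀ p ∈ Ω, 0 < Wrep₁ f₂ g₂ p.1 p.2)
    (hG : ∀ p ∈ Ω, 0 < Wrep₂ f₂ g₂ p.1 p.2)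
    (hden₁ : ∀ p ∈ Ω, g₂ p.2 * (f₂ p.1 + p.1 * deriv f₂ p.1) ≠ 0)
    (hden₂ : ∀ p ∈ Ω, f₂ p.1 * (g₂ p.2 + p.2 * deriv g₂ p.2) ≠ 0) :
    IsWaveMap Ω (fun s t => 2 * Real.log (Wrep₁ f₂ g₂ s t))
      (fun s t => 2 * Real.log (Wrep₂ f₂ g₂ s t)) ∧
    (∀ p ∈ Ω,
      Real.exp ((2 * Real.log (Wrep₁ f₂ g₂ p.1 p.2) +
          2 * Real.log (Wrep₂ f₂ g₂ p.1 p.2)) / 2) =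
        Wrep₁ f₂ g₂ p.1 p.2 * Wrep₂ f₂ g₂ p.1 p.2) ∧
    (∀ f₁ g₁ : ℝ → ℝ, ContDiff ℝ 2 f₁ → ContDiff ℝ 2 g₁ →
      (∀ s, deriv f₁ s ≠ 0) → (∀ t, deriv g₁ t ≠ 0) →
      ∀ u₀ v₀ : ℝ → ℝ → ℝ,
        ContDiffOn ℝ 2 (fun p : ℝ × ℝ => u₀ p.1 p.2)
          ((fun p : ℝ × ℝ => (f₁ p.1, g₁ p.2)) '' Ω) →
        ContDiffOn ℝ 2 (fun p : ℝ × ℝ => v₀ p.1 p.2)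
          ((fun p : ℝ × ℝ => (f₁ p.1, g₁ p.2)) '' Ω) →
        (∀ p ∈ Ω, u₀ (f₁ p.1) (g₁ p.2) = 2 * Real.log (Wrep₁ f₂ g₂ p.1 p.2)) →
        (∀ p ∈ Ω, v₀ (f₁ p.1) (g₁ p.2) = 2 * Real.log (Wrep₂ f₂ g₂ p.1 p.2)) →
        IsWaveMap ((fun p : ℝ × ℝ => (f₁ p.1, g₁ p.2)) '' Ω) u₀ v₀) := by
  refine ⟨?_, fun p hp => exp_half_two_mul_log_add (hF p hp) (hG p hp), ?_⟩
  · have h := isWaveMap_image_of_eq_two_mul_log hf₂ hg₂ hΩ hF hG hden₁ hden₂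
      (f₁ := fun s => s) (g₁ := fun t => t) contDiff_id contDiff_id (by simp) (by simp)
      (u := fun s t => 2 * Real.log (Wrep₁ f₂ g₂ s t))
      (v := fun s t => 2 * Real.log (Wrep₂ f₂ g₂ s t)) (fun _ _ => rfl) (fun _ _ => rfl)
    simpa using h
  · intro f₁ g₁ hf₁ hg₁ hf₁0 hg₁0 u₀ v₀ _ _ hu hv
    exact isWaveMap_image_of_eq_two_mul_log hf₂ hg₂ hΩ hF hG hden₁ hden₂
      hf₁ hg₁ hf₁0 hg₁0 hu hv
end

section
/- (Linearizing substitution for the Riccati equation.) Let I ⊆ ℝ be an open interval, t₀ ∈ I, and let α₀, α₁, α₂ : I → ℝ be continuous with α₂(t) ≠ 0 for all t ∈ I. Define p(t) = exp(∫_{t₀}^t 2α₁(r) dr) and τ(t) = ∫_{t₀}^t α₂(r) p(r) dr. Let y : ℝ → ℝ be differentiable and set z(t) = p(t)·y(τ(t)) for t ∈ I. Then z satisfies the Riccati equation z′(t) = α₀(t) + 2α₁(t) z(t) − α₂(t) z(t)² for all t ∈ I if and only if y′(τ(t)) = α₀(t)/(α₂(t) p(t)²) − y(τ(t))² for all t ∈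 I. -/
theorem ContinuousOn.hasDerivAt_intervalIntegral {I : Set ℝ} (hI : IsOpen I)
    (hI' : I.OrdConnected) {f : ℝ → ℝ} (hf : ContinuousOn f I) {t₀ t : ℝ}
    (ht₀ : t₀ ∈ I) (ht : t ∈ I) :
    HasDerivAt (fun u => ∫ r in t₀..u, f r) (f t) t :=
  intervalIntegral.integral_hasDerivAt_right
    ((hf.mono (hI'.uIcc_subset ht₀ ht)).intervalIntegrable)
    (hf.stronglyMeasurableAtFilter hI t ht)
    (hf.continuousAt (hI.mem_nhds ht))

/-- linearizing substitution for the Riccati equation: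
with `p(t) = exp(∫_{t₀}^t 2α₁)` and `τ(t) = ∫_{t₀}^t α₂ p`, the function
`z(t) = p(t) y(τ(t))` solves `z' = α₀ + 2α₁ z - α₂ z²` on `I` iff
`y'(τ(t)) = α₀(t)/(α₂(t) p(t)²) - y(τ(t))²` on `I`. -/
theorem riccati_linearizing_substitution
    (I : Set ℝ) (hIopen : IsOpen I) (hIinterval : I.OrdConnected)
    (t₀ : ℝ) (ht₀ : t₀ ∈ I)
    (α₀ α₁ α₂ : ℝ → ℝ)
    (hc₀ : ContinuousOn α₀ I) (hc₁ : ContinuousOn α₁ I) (hc₂ : ContinuousOn α₂ I)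
    (hα₂ : ∀ t ∈ I, α₂ t ≠ 0)
    (p τ : ℝ → ℝ)
    (hp : ∀ t, p t = Real.exp (∫ r in t₀..t, 2 * α₁ r))
    (hτ : ∀ t, τ t = ∫ r in t₀..t, α₂ r * p r)
    (y : ℝ → ℝ) (hy : Differentiable ℝ y)
    (z : ℝ → ℝ) (hz : ∀ t, z t = p t * y (τ t)) :
    (∀ t ∈ I, deriv z t = α₀ t + 2 * α₁ t * z t - α₂ t * z t ^ 2) ↔
      (∀ t ∈ I, deriv y (τ t) = α₀ t / (α₂ t * p t ^ 2) - y (τ t) ^ 2) := by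
  have hp' (t) (ht : t ∈ I) : HasDerivAt p (p t * (2 * α₁ t)) t := by
    rw [funext hp]
    exact ((continuousOn_const.mul hc₁).hasDerivAt_intervalIntegral
      hIopen hIinterval ht₀ ht).exp
  have hp_cont : ContinuousOn p I := fun t ht => (hp' t ht).continuousAt.continuousWithinAt
  have hτ' (t) (ht : t ∈ I) : HasDerivAt τ (α₂ t * p t) t := by
    rw [funext hτ]
    exact (hc₂.mul hp_cont).hasDerivAt_intervalIntegral hIopen hIinterval ht₀ ht
  have hz' (t) (ht : t ∈ I) :
      deriv z t = p t * (2 * α₁ t) * y (τ t) + p t * (deriv y (τ t) * (α₂ t * p t)) := by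
    rw [funext hz]
    exact ((hp' t ht).mul ((hy (τ t)).hasDerivAt.comp t (hτ' t ht))).deriv
  refine forall₂_congr fun t ht => ?_
  have hpt : p t ≠ 0 := by
    rw [hp]
    exact Real.exp_ne_zero _
  have hαp : α₂ t * p t ^ 2 ≠ 0 := mul_ne_zero (hα₂ t ht) (pow_ne_zero 2 hpt)
  rw [hz' t ht, hz t, eq_sub_iff_add_eq (a := deriv y (τ t)), eq_div_iff hαp]
  constructor <;> intro h <;> linear_combination h
end

section
/- (Explicit reduced fundamental solution for the Riccati equation 2Γ′ = −2y − (y+1)Γ − Γ².) Define erfi(x) = (2/√π) ∫₀ˣ exp(t²) dt. Then the functions γ₁(y) = exp((y−1)(y−5)/8) and γ₂(y) = (√π/2) exp(−(y−3)²/8 − 1/2) ( erfi(1) + erfi((y−3)/2) ) satisfy, for all y ∈ ℝ, the reduced fundamental system γ₁′(y) = ((y−3)/4) γ₁(y), γ₂′(y) = (1/2) γ₁(y) − ((y−3)/4) γ₂(y), together with the initial conditions γ₁(1) = 1 and γ₂(1) = 0. -/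
/-- The imaginary error function `erfi(x) = (2/√π) ∫₀ˣ exp(t²) dt`. -/
noncomputable def erfi (x : ℝ) : ℝ :=
  (2 / Real.sqrt Real.pi) * ∫ t in (0:ℝ)..x, Real.exp (t ^ 2)

/-- `γ₁(y) = exp((y-1)(y-5)/8)`. -/
noncomputable def redγ₁ (y : ℝ) : ℝ := Real.exp ((y - 1) * (y - 5) / 8)

/-- `γ₂(y) = (√π/2) exp(-(y-3)²/8 - 1/2)(erfi(1) + erfi((y-3)/2))`. -/
noncomputable def redγ₂ (y : ℝ) : ℝ :=
  Real.sqrt Real.pi / 2 * Real.exp (-(y - 3) ^ 2 / 8 - 1 / 2) *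
    (erfi 1 + erfi ((y - 3) / 2))

theorem hasDerivAt_erfi (x : ℝ) :
    HasDerivAt erfi (2 / Real.sqrt Real.pi * Real.exp (x ^ 2)) x := by
  have hc : Continuous fun t : ℝ => Real.exp (t ^ 2) := by fun_prop
  exact (hc.integral_hasStrictDerivAt 0 x).hasDerivAt.const_mul _

theorem erfi_neg (x : ℝ) : erfi (-x) = -erfi x := by
  have h := intervalIntegral.integral_comp_neg (a := 0) (b := x)
    (fun t : ℝ => Real.exp (t ^ 2))
  simp only [neg_sq, neg_zero] at h
  rw [erfi, erfi, h, intervalIntegral.integral_symm]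
  ring

theorem hasDerivAt_redγ₁ (y : ℝ) : HasDerivAt redγ₁ ((y - 3) / 4 * redγ₁ y) y := by
  have h := ((((hasDerivAt_id' y).sub_const 1).mul
    ((hasDerivAt_id' y).sub_const 5)).div_const 8).exp
  refine h.congr_deriv ?_
  simp only [redγ₁, Pi.mul_apply]
  ring

theorem hasDerivAt_redγ₂ (y : ℝ) :
    HasDerivAt redγ₂ (1 / 2 * redγ₁ y - (y - 3) / 4 * redγ₂ y) y := by
  have hl := (hasDerivAt_id' y).sub_const 3
  have hE : HasDerivAt (fun z : ℝ => Real.exp (-(z - 3) ^ 2 / 8 - 1 / 2))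
      (-((y - 3) / 4) * Real.exp (-(y - 3) ^ 2 / 8 - 1 / 2)) y := by
    refine ((((hl.pow 2).neg.div_const 8).sub_const (1 / 2)).exp).congr_deriv ?_
    simp only [Pi.neg_apply, Pi.pow_apply]
    ring
  have hF : HasDerivAt (fun z : ℝ => erfi 1 + erfi ((z - 3) / 2))
      (2 / Real.sqrt Real.pi * Real.exp (((y - 3) / 2) ^ 2) * (1 / 2)) y :=
    ((hasDerivAt_erfi ((y - 3) / 2)).comp y (hl.div_const 2)).const_add _
  refine ((hE.const_mul (Real.sqrt Real.pi / 2)).mul hF).congr_deriv ?_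
  have hexp : redγ₁ y =
      Real.exp (-(y - 3) ^ 2 / 8 - 1 / 2) * Real.exp (((y - 3) / 2) ^ 2) := by
    rw [redγ₁, ← Real.exp_add]
    ring_nf
  have hpi : Real.sqrt Real.pi ≠ 0 := (Real.sqrt_pos.2 Real.pi_pos).ne'
  rw [hexp, redγ₂]
  field_simp
  ring

/-- explicit reduced fundamental solution for the Riccati equation
`2Γ' = -2y - (y+1)Γ - Γ²`: the explicit functions `redγ₁`, `redγ₂` satisfy
`γ₁' = ((y-3)/4)γ₁`, `γ₂' = (1/2)γ₁ - ((y-3)/4)γ₂`, with `γ₁(1) = 1`, `γ₂(1) = 0`. -/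
theorem explicit_reduced_fundamental_solution :
    (∀ y : ℝ, HasDerivAt redγ₁ ((y - 3) / 4 * redγ₁ y) y) ∧
    (∀ y : ℝ, HasDerivAt redγ₂ (1 / 2 * redγ₁ y - (y - 3) / 4 * redγ₂ y) y) ∧
    redγ₁ 1 = 1 ∧ redγ₂ 1 = 0 := by
  refine ⟨hasDerivAt_redγ₁, hasDerivAt_redγ₂, by simp [redγ₁], ?_⟩
  have h : ((1 : ℝ) - 3) / 2 = -1 := by norm_num
  rw [redγ₂, h, erfi_neg, add_neg_cancel, mul_zero]
end

section
/- (Vessiot algebra of the Darboux integrable wave map system.) On the open set Ω = {(z₁, z₂, z₃, z₄) ∈ ℝ⁴ : z₁ ≠ 0, z₂ ≠ 0, z₃ ≠ 0}, define the vector fields R₁(z) = (z₁, −z₂, −2z₃, 0), R₂(z) = (0, (1+z₁z₂)/(z₁z₃), 1, −z₄/(z₁z₂z₃)), R₃(z) = (z₁z₃, 0, −z₃², 0) and R₄(z) = (−z₁/4, z₂/4, 0, 0). Then at every point of Ω the Lie brackets satisfy [R₁, R₂] = 2R₂, [R₁, R₃] = −2R₃, [R₂, R₃] = R₁, and [R₄,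 Rᵢ] = 0 for i = 1, 2, 3; hence R₁, R₂, R₃ span a Lie algebra of vector fields isomorphic to sl(2,ℝ) and R₁, R₂, R₃, R₄ one isomorphic to sl(2,ℝ) ⊕ ℝ. -/
/-- Lie bracket of vector fields on (an open subset of) `ℝ⁴`:
`[X, Y](z) = DY(z)·X(z) - DX(z)·Y(z)`. -/
noncomputable def lieBracket (X Y : ℝ × ℝ × ℝ × ℝ → ℝ × ℝ × ℝ × ℝ)
    (z : ℝ × ℝ × ℝ × ℝ) : ℝ × ℝ × ℝ × ℝ :=
  fderiv ℝ Y z (X z) - fderiv ℝ X z (Y z)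

/-- `R₁ = z₁∂₁ - z₂∂₂ - 2z₃∂₃`. -/
def vR₁ (z : ℝ × ℝ × ℝ × ℝ) : ℝ × ℝ × ℝ × ℝ :=
  (z.1, -z.2.1, -2 * z.2.2.1, 0)

/-- `R₂ = ((1+z₁z₂)/(z₁z₃))∂₂ + ∂₃ - (z₄/(z₁z₂z₃))∂₄`. -/
noncomputable def vR₂ (z : ℝ × ℝ × ℝ × ℝ) : ℝ × ℝ × ℝ × ℝ :=
  (0, (1 + z.1 * z.2.1) / (z.1 * z.2.2.1), 1, -z.2.2.2 / (z.1 * z.2.1 * z.2.2.1))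

/-- `R₃ = z₁z₃∂₁ - z₃²∂₃`. -/
def vR₃ (z : ℝ × ℝ × ℝ × ℝ) : ℝ × ℝ × ℝ × ℝ :=
  (z.1 * z.2.2.1, 0, -z.2.2.1 ^ 2, 0)

/-- `R₄ = -(1/4)(z₁∂₁ - z₂∂₂)`. -/
noncomputable def vR₄ (z : ℝ × ℝ × ℝ × ℝ) : ℝ × ℝ × ℝ × ℝ :=
  (-z.1 / 4, z.2.1 / 4, 0, 0)

/-- The open set `z₁ ≠ 0, z₂ ≠ 0, z₃ ≠ 0`. -/
def Ω₁₄ : Set (ℝ × ℝ × ℝ × ℝ) :=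
  {z : ℝ × ℝ × ℝ × ℝ | z.1 ≠ 0 ∧ z.2.1 ≠ 0 ∧ z.2.2.1 ≠ 0}

section FDeriv

variable (z v : ℝ × ℝ × ℝ × ℝ)

theorem hasFDerivAt_coord₁ :
    HasFDerivAt (fun w : ℝ × ℝ × ℝ × ℝ => w.1) (ContinuousLinearMap.fst ℝ ℝ (ℝ × ℝ × ℝ)) z :=
  hasFDerivAt_fst

theorem hasFDerivAt_coord₂ :
    HasFDerivAt (fun w : ℝ × ℝ × ℝ × ℝ => w.2.1)
      ((ContinuousLinearMap.fst ℝ ℝ (ℝ × ℝ)).comp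
        (ContinuousLinearMap.snd ℝ ℝ (ℝ × ℝ × ℝ))) z :=
  hasFDerivAt_snd.fst

theorem hasFDerivAt_coord₃ :
    HasFDerivAt (fun w : ℝ × ℝ × ℝ × ℝ => w.2.2.1)
      ((ContinuousLinearMap.fst ℝ ℝ ℝ).comp ((ContinuousLinearMap.snd ℝ ℝ (ℝ × ℝ)).comp
        (ContinuousLinearMap.snd ℝ ℝ (ℝ × ℝ × ℝ)))) z :=
  hasFDerivAt_snd.snd.fst

theorem hasFDerivAt_coord₄ :
    HasFDerivAt (fun w : ℝ × ℝ × ℝ × ℝ => w.2.2.2)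
      ((ContinuousLinearMap.snd ℝ ℝ ℝ).comp ((ContinuousLinearMap.snd ℝ ℝ (ℝ × ℝ)).comp
        (ContinuousLinearMap.snd ℝ ℝ (ℝ × ℝ × ℝ)))) z :=
  hasFDerivAt_snd.snd.snd

theorem hasFDerivAt_div {E : Type*} [NormedAddCommGroup E] [NormedSpace ℝ E] {f g : E → ℝ}
    {Df Dg : E →L[ℝ] ℝ} {x : E} (hf : HasFDerivAt f Df x) (hg : HasFDerivAt g Dg x)
    (hx : g x ≠ 0) :
    HasFDerivAt (fun y => f y / g y) (f x • (-(g x ^ 2)⁻¹ • Dg) + (g x)⁻¹ • Df) x :=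
  hf.mul ((hasDerivAt_inv hx).comp_hasFDerivAt x hg)

theorem fderiv_vR₁ : fderiv ℝ vR₁ z v = (v.1, -v.2.1, -2 * v.2.2.1, 0) := by
  have h : HasFDerivAt vR₁ _ z :=
    (hasFDerivAt_coord₁ z).prodMk ((hasFDerivAt_coord₂ z).neg.prodMk
      (((hasFDerivAt_coord₃ z).const_mul (-2)).prodMk (hasFDerivAt_const (0 : ℝ) z)))
  rw [h.fderiv]
  simp

theorem fderiv_vR₂ (hz : z ∈ Ω₁₄) :
    fderiv ℝ vR₂ z v =
      (0,
        ((z.1 * v.2.1 + z.2.1 * v.1) * (z.1 * z.2.2.1) -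
          (1 + z.1 * z.2.1) * (z.1 * v.2.2.1 + z.2.2.1 * v.1)) / (z.1 * z.2.2.1) ^ 2,
        0,
        (z.2.2.2 * (z.1 * z.2.1 * v.2.2.1 + z.2.2.1 * (z.1 * v.2.1 + z.2.1 * v.1)) -
          v.2.2.2 * (z.1 * z.2.1 * z.2.2.1)) / (z.1 * z.2.1 * z.2.2.1) ^ 2) := by
  obtain ⟨h₁, h₂, h₃⟩ := hz
  have h : HasFDerivAt vR₂ _ z :=
    (hasFDerivAt_const (0 : ℝ) z).prodMk
      ((hasFDerivAt_div
          (((hasFDerivAt_coord₁ z).mul (hasFDerivAt_coord₂ z)).const_add 1)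
          ((hasFDerivAt_coord₁ z).mul (hasFDerivAt_coord₃ z)) (mul_ne_zero h₁ h₃)).prodMk
        ((hasFDerivAt_const (1 : ℝ) z).prodMk
          (hasFDerivAt_div (hasFDerivAt_coord₄ z).neg
            (((hasFDerivAt_coord₁ z).mul (hasFDerivAt_coord₂ z)).mul (hasFDerivAt_coord₃ z))
            (mul_ne_zero (mul_ne_zero h₁ h₂) h₃))))
  rw [h.fderiv]
  ext <;> simp <;> field_simp <;> ring

theorem fderiv_vR₃ :
    fderiv ℝ vR₃ z v =
      (z.1 * v.2.2.1 + z.2.2.1 * v.1, 0, -(2 * z.2.2.1 * v.2.2.1), 0) := by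
  have h : HasFDerivAt vR₃ _ z :=
    ((hasFDerivAt_coord₁ z).mul (hasFDerivAt_coord₃ z)).prodMk
      ((hasFDerivAt_const (0 : ℝ) z).prodMk
        (((hasFDerivAt_coord₃ z).pow 2).neg.prodMk (hasFDerivAt_const (0 : ℝ) z)))
  rw [h.fderiv]
  simp

theorem fderiv_vR₄ : fderiv ℝ vR₄ z v = (-v.1 / 4, v.2.1 / 4, 0, 0) := by
  have h : HasFDerivAt vR₄ _ z :=
    ((hasFDerivAt_coord₁ z).neg.mul_const (4⁻¹ : ℝ)).prodMk
      (((hasFDerivAt_coord₂ z).mul_const (4⁻¹ : ℝ)).prodMk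
        ((hasFDerivAt_const (0 : ℝ) z).prodMk (hasFDerivAt_const (0 : ℝ) z)))
  rw [h.fderiv]
  ext <;> simp <;> ring

end FDeriv

/-- Vessiot algebra of the Darboux integrable wave map system:
on `Ω₁₄` the vector fields `R₁, R₂, R₃, R₄` satisfy `[R₁,R₂] = 2R₂`,
`[R₁,R₃] = -2R₃`, `[R₂,R₃] = R₁` and `[R₄,Rᵢ] = 0` for `i = 1,2,3`; hence
`R₁,R₂,R₃` span a copy of `sl(2,ℝ)` and `R₁,…,R₄` one of `sl(2,ℝ) ⊕ ℝ`. -/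
theorem vessiot_algebra_structure :
    ∀ z ∈ Ω₁₄,
      lieBracket vR₁ vR₂ z = (2 : ℝ) • vR₂ z ∧
      lieBracket vR₁ vR₃ z = (-2 : ℝ) • vR₃ z ∧
      lieBracket vR₂ vR₃ z = vR₁ z ∧
      lieBracket vR₄ vR₁ z = 0 ∧
      lieBracket vR₄ vR₂ z = 0 ∧
      lieBracket vR₄ vR₃ z = 0 := by
  intro z hz
  have d₂ := fun v => fderiv_vR₂ z v hz
  obtain ⟨h₁, h₂, h₃⟩ := hz
  simp only [lieBracket, d₂, fderiv_vR₁, fderiv_vR₃, fderiv_vR₄]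
  simp only [vR₁, vR₂, vR₃, vR₄, Prod.ext_iff, Prod.fst_sub, Prod.snd_sub, Prod.smul_fst,
    Prod.smul_snd, Prod.fst_zero, Prod.snd_zero, smul_eq_mul]
  refine ⟨⟨?_, ?_, ?_, ?_⟩, ⟨?_, ?_, ?_, ?_⟩, ⟨?_, ?_, ?_, ?_⟩, ⟨?_, ?_, ?_, ?_⟩,
    ⟨?_, ?_, ?_, ?_⟩, ⟨?_, ?_, ?_, ?_⟩⟩ <;> field_simp <;> ring
end
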